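/- Under the framework assumptions on the structure of the system and on the data, assume in addition that there exists u_∞ ∈ H such that u − u_∞ ∈ L²(0,+∞;H), let (y,μ) be a solution of the fractional Cahn–Hilliard system, and suppose λ₁ > 0. Then every element y_ω of the ω-limit set ω := {y_ω ∈ V_B^σ : y(t_n) → y_ω weakly in V_B^σ for some sequence t_n ↗ +∞} satisfies the stationary variational inequality (B^σ y_ω, B^σ(y_ω − v)) + ∫_Ω β̂(y_ω) + (π(y_ω) − u_∞, y_ω − v) ≤ ∫_Ω β̂(v) for every v ∈ V_B^σ. -/

import Mathlib

noncomputable section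

open MeasureTheory Filter Topology RealInnerProductSpace Set ENNReal NNReal

namespace FracCH

/-- The ambient space `ℝ³`. -/
abbrev E3 := EuclideanSpace ℝ (Fin 3)

/-- Lebesgue measure restricted to `Om`. -/
abbrev mOm (Om : Set E3) : Measure E3 := volume.restrict Om

/-- The Hilbert space `H = L²(Om)`. -/
abbrev Hs (Om : Set E3) := MeasureTheory.Lp ℝ 2 (mOm Om)

/-- The fractional power (in the spectral sense) with exponent `ρ` of the operator whose
eigenvalues are `lam` and whose orthonormal eigenvectors are `e`. -/
def fracPow {Om : Set E3} (lam : ℕ → ℝ) (e : ℕ → Hs Om) (ρ : ℝ) (v : Hs Om) : Hs Om :=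
  ∑' j, ((lam j) ^ ρ * ⟪v, e j⟫) • e j

/-- Membership in the domain of the fractional power of exponent `ρ`. -/
def inDom {Om : Set E3} (lam : ℕ → ℝ) (e : ℕ → Hs Om) (ρ : ℝ) (v : Hs Om) : Prop :=
  Summable fun j => ((lam j) ^ ρ * ⟪v, e j⟫) ^ 2

/-- Mean value of `v` on `Om`. -/
def meanVal {Om : Set E3} (v : Hs Om) : ℝ := (∫ x, v x ∂(mOm Om)) / (volume Om).toReal

/-- Subdifferential of a convex function `b : ℝ → [0,+∞]`. -/
def subdiff (b : ℝ → ℝ≥0∞) (s : ℝ) : Set ℝ :=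
  {ξ | b s < ⊤ ∧ ∀ t : ℝ, ENNReal.ofReal ((b s).toReal + ξ * (t - s)) ≤ b t}

/-- Square of the graph norm of the domain of a fractional power. -/
def gnormSq {Om : Set E3} (lam : ℕ → ℝ) (e : ℕ → Hs Om) (ρ : ℝ) (v : Hs Om) : ℝ :=
  ‖v‖ ^ 2 + ‖fracPow lam e ρ v‖ ^ 2

/-- Square of the dual norm (the norm of `V_A^{-r}`) of a linear functional. -/
def dualNormSq {Om : Set E3} (lam : ℕ → ℝ) (e : ℕ → Hs Om) (ρ : ℝ)
    (f : Hs Om →ₗ[ℝ] ℝ) : ℝ :=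
  sSup {a : ℝ | ∃ v : Hs Om, inDom lam e ρ v ∧ gnormSq lam e ρ v ≤ 1 ∧ a = (f v) ^ 2}

/-- The inner product of the Hilbert space which is the domain of a fractional power
(e.g.`V_B^σ`). -/
def innerFrac {Om : Set E3} (lam : ℕ → ℝ) (e : ℕ → Hs Om) (ρ : ℝ) (a b : Hs Om) : ℝ :=
  ⟪a, b⟫ + ⟪fracPow lam e ρ a, fracPow lam e ρ b⟫

/-- The structural assumptions: `Om ⊂ ℝ³` is open, connected and bounded; `A` and `B` are
unbounded monotone selfadjoint operators with compact resolvents, described by their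
nondecreasing sequences of eigenvalues `lamA`, `lamB` (tending to `+∞`) and complete
orthonormal systems of eigenvectors `eA`, `eB`; `r, σ > 0`, `τ ∈ [0,1]`; either `λ₁ > 0`
or `0 = λ₁ < λ₂` with `e₁` constant; if `λ₁ = 0` the constants belong to `V_B^σ`. -/
def SettingHyps (Om : Set E3) (lamA lamB : ℕ → ℝ) (eA eB : ℕ → Hs Om)
    (r σ τ : ℝ) : Prop :=
  IsOpen Om ∧ IsConnected Om ∧ Bornology.IsBounded Om ∧
  (∀ j, 0 ≤ lamA j) ∧ (∀ j, 0 ≤ lamB j) ∧ Monotone lamA ∧ Monotone lamB ∧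
  Tendsto lamA atTop atTop ∧ Tendsto lamB atTop atTop ∧
  Orthonormal ℝ eA ∧ Orthonormal ℝ eB ∧
  (Submodule.span ℝ (Set.range eA)).topologicalClosure = ⊤ ∧
  (Submodule.span ℝ (Set.range eB)).topologicalClosure = ⊤ ∧
  0 < r ∧ 0 < σ ∧ τ ∈ Set.Icc (0:ℝ) 1 ∧
  (0 < lamA 0 ∨ (lamA 0 = 0 ∧ 0 < lamA 1 ∧ ∃ c : ℝ, ∀ᵐ x ∂(mOm Om), eA 0 x = c)) ∧
  (lamA 0 = 0 → ∀ c : ℝ, ∃ w : Hs Om, inDom lamB eB σ w ∧ (∀ᵐ x ∂(mOm Om), w x = c))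

/-- The assumptions on the nonlinearity `f = β̂ + π̂` and on the data `u`, `y₀`:
`β̂ : ℝ → [0,+∞]` is convex, l.s.c., with `β̂(0) = 0`; `π̂` is `C¹` with Lipschitz
continuous derivative `π`; the coercivity `liminf_{|s|→∞}(β̂(s)+π̂(s))/s² > 0` holds;
`u ∈ W^{1,1}_loc([0,∞);H)` with primitive representation by `u'` and `∂_t u ∈ L¹(0,∞;H)`;
`y₀ ∈ V_B^σ` with `β̂(y₀) ∈ L¹(Om)`; and if `λ₁ = 0` the mean of `y₀` lies in the
interior of `D(β)`. -/
def DataHyps (Om : Set E3) (lamA lamB : ℕ → ℝ) (eB : ℕ → Hs Om) (σ : ℝ)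
    (betah : ℝ → ℝ≥0∞) (pih piF : ℝ → ℝ) (Lpi : ℝ≥0)
    (u u' : ℝ → Hs Om) (y0 : Hs Om) : Prop :=
  (∀ a b t : ℝ, 0 ≤ t → t ≤ 1 →
    betah (t * a + (1 - t) * b) ≤ ENNReal.ofReal t * betah a + ENNReal.ofReal (1 - t) * betah b) ∧
  LowerSemicontinuous betah ∧ betah 0 = 0 ∧
  (∀ s, HasDerivAt pih (piF s) s) ∧ LipschitzWith Lpi piF ∧
  (∃ α : ℝ, 0 < α ∧ ∀ᶠ s : ℝ in Filter.comap (|·|) atTop,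
    ENNReal.ofReal (α * s ^ 2 - pih s) ≤ betah s) ∧
  IntegrableOn u' (Set.Ioi (0:ℝ)) ∧
  (∀ t : ℝ, 0 ≤ t → u t = u 0 + ∫ s in (0:ℝ)..t, u' s) ∧
  inDom lamB eB σ y0 ∧ (∫⁻ x, betah (y0 x) ∂(mOm Om)) < ⊤ ∧
  (lamA 0 = 0 → meanVal y0 ∈ interior {s : ℝ | (subdiff betah s).Nonempty})

/-- The notion of solution `(y, μ)` of the weak formulation of the fractional
Cahn--Hilliard system on the half line `t ≥ 0`.  Here `dy t ∈ V_A^{-r}` represents the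
time derivative `∂_t y(t)` (acting on test functions, and linked to `y` by the integral
identity `(y(t),v) = (y(0),v) + ∫_0^t ⟨∂_t y(s),v⟩ ds`), while `z` represents
`τ ∂_t y ∈ L²(0,T;H)`.  The requirements are the regularity
`y ∈ L^∞(0,T;V_B^σ)`, `∂_t y ∈ L²(0,T;V_A^{-r})`, `τ ∂_t y ∈ L²(0,T;H)`,
`μ ∈ L²(0,T;V_A^r)`, `β̂(y) ∈ L¹(Om×(0,T))` for every `T > 0`, the two variational
equations/inequalities for a.a. `t`, and the initial condition `y(0) = y₀`. -/
def IsSolution (Om : Set E3) (lamA lamB : ℕ → ℝ) (eA eB : ℕ → Hs Om) (r σ τ : ℝ)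
    (betah : ℝ → ℝ≥0∞) (piF : ℝ → ℝ) (u : ℝ → Hs Om) (y0 : Hs Om)
    (y μ : ℝ → Hs Om) (dy : ℝ → Hs Om →ₗ[ℝ] ℝ) (z : ℝ → Hs Om) : Prop :=
  AEStronglyMeasurable y (volume.restrict (Set.Ioi (0:ℝ))) ∧
  (∀ᵐ t ∂(volume.restrict (Set.Ioi (0:ℝ))), inDom lamB eB σ (y t)) ∧
  (∀ T : ℝ, 0 < T → ∃ C : ℝ,
    ∀ᵐ t ∂(volume.restrict (Set.Ioc (0:ℝ) T)), gnormSq lamB eB σ (y t) ≤ C) ∧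
  (∀ v : Hs Om, inDom lamA eA r v → ∀ T : ℝ, 0 < T →
    IntegrableOn (fun s => dy s v) (Set.Ioc (0:ℝ) T)) ∧
  (∀ v : Hs Om, inDom lamA eA r v → ∀ t : ℝ, 0 ≤ t →
    ⟪y t, v⟫ = ⟪y 0, v⟫ + ∫ s in (0:ℝ)..t, dy s v) ∧
  (∀ T : ℝ, 0 < T → IntegrableOn (fun t => dualNormSq lamA eA r (dy t)) (Set.Ioc (0:ℝ) T)) ∧
  AEStronglyMeasurable z (volume.restrict (Set.Ioi (0:ℝ))) ∧
  (∀ᵐ t ∂(volume.restrict (Set.Ioi (0:ℝ))), ∀ v : Hs Om, inDom lamA eA r v →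
    ⟪z t, v⟫ = τ * dy t v) ∧
  (∀ T : ℝ, 0 < T → IntegrableOn (fun t => ‖z t‖ ^ 2) (Set.Ioc (0:ℝ) T)) ∧
  AEStronglyMeasurable μ (volume.restrict (Set.Ioi (0:ℝ))) ∧
  (∀ᵐ t ∂(volume.restrict (Set.Ioi (0:ℝ))), inDom lamA eA r (μ t)) ∧
  (∀ T : ℝ, 0 < T → IntegrableOn (fun t => gnormSq lamA eA r (μ t)) (Set.Ioc (0:ℝ) T)) ∧
  (∀ T : ℝ, 0 < T → (∫⁻ t in Set.Ioc (0:ℝ) T, ∫⁻ x, betah (y t x) ∂(mOm Om)) < ⊤) ∧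
  (∀ᵐ t ∂(volume.restrict (Set.Ioi (0:ℝ))), ∀ v : Hs Om, inDom lamA eA r v →
    dy t v + ⟪fracPow lamA eA r (μ t), fracPow lamA eA r v⟫ = 0) ∧
  (∀ᵐ t ∂(volume.restrict (Set.Ioi (0:ℝ))), ∀ v : Hs Om,
    inDom lamB eB σ v → (∫⁻ x, betah (v x) ∂(mOm Om)) < ⊤ →
    ⟪z t, y t - v⟫
      + ⟪fracPow lamB eB σ (y t), fracPow lamB eB σ (y t) - fracPow lamB eB σ v⟫
      + (∫⁻ x, betah (y t x) ∂(mOm Om)).toReal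
      + ∫ x, (piF (y t x) - u t x) * (y t x - v x) ∂(mOm Om)
      ≤ ⟪μ t, y t - v⟫ + (∫⁻ x, betah (v x) ∂(mOm Om)).toReal) ∧
  y 0 = y0

/-- The ω-limit set of the trajectory `y`, in the weak topology of `V_B^σ`. -/
def omegaLimit {Om : Set E3} (lamB : ℕ → ℝ) (eB : ℕ → Hs Om) (σ : ℝ)
    (y : ℝ → Hs Om) : Set (Hs Om) :=
  {w | inDom lamB eB σ w ∧ ∃ tn : ℕ → ℝ, StrictMono tn ∧ (∀ n, 0 ≤ tn n) ∧
    Tendsto tn atTop atTop ∧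
    ∀ φ : Hs Om, inDom lamB eB σ φ →
      Tendsto (fun n => innerFrac lamB eB σ (y (tn n)) φ) atTop
        (nhds (innerFrac lamB eB σ w φ))}

/-! ### Averages of locally integrable functions -/

section Averages

/-- A locally integrable function on the line is integrable on every interval. -/
theorem intervalIntegrable_of_locallyIntegrable {X : Type*} [NormedAddCommGroup X] {f : ℝ → X}
    (hf : LocallyIntegrable f) (a b : ℝ) : IntervalIntegrable f volume a b :=
  (hf.integrableOn_isCompact isCompact_uIcc).intervalIntegrable

theorem locallyIntegrable_comp_sub {X : Type*} [NormedAddCommGroup X] {f : ℝ → X}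
    (hf : LocallyIntegrable f) (h : ℝ) (a b : ℝ) :
    IntervalIntegrable (fun t => f (t - h)) volume a b := by
  have := (intervalIntegrable_of_locallyIntegrable hf (a - h) (b - h)).comp_sub_right h
  simpa using this

/-- Steklov averages are continuous. -/
theorem continuous_steklov {X : Type*} [NormedAddCommGroup X] [NormedSpace ℝ X]
    {k : ℝ → X} (hk : LocallyIntegrable k) (δ : ℝ) :
    Continuous (fun t => ∫ s in (t - δ)..t, k s) := by
  have hIk := intervalIntegrable_of_locallyIntegrable hk
  have hck : Continuous (fun x => ∫ t in (0:ℝ)..x, k t) :=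
    intervalIntegral.continuous_primitive hIk 0
  have : (fun t => ∫ s in (t - δ)..t, k s) =
      fun t => (∫ s in (0:ℝ)..t, k s) - ∫ s in (0:ℝ)..(t - δ), k s := by
    ext1 t; exact (intervalIntegral.integral_interval_sub_left (hIk _ _) (hIk _ _)).symm
  rw [this]; exact hck.sub (hck.comp (continuous_id.sub continuous_const))

/-- Difference quotients integrate to the increment between Lebesgue points. -/
theorem tendsto_integral_backward_difference {E : ℝ → ℝ} (hE : LocallyIntegrable E) {a b : ℝ}
    (ha : HasDerivAt (fun x => ∫ t in (0:ℝ)..x, E t) (E a) a)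
    (hb : HasDerivAt (fun x => ∫ t in (0:ℝ)..x, E t) (E b) b) :
    Tendsto (fun h => h⁻¹ * ∫ t in a..b, (E t - E (t - h))) (𝓝[>] 0) (𝓝 (E b - E a)) := by
  have hI := intervalIntegrable_of_locallyIntegrable hE
  have key : ∀ c : ℝ, HasDerivAt (fun x => ∫ t in (0:ℝ)..x, E t) (E c) c →
      Tendsto (fun h => h⁻¹ * ∫ t in (c - h)..c, E t) (𝓝[>] 0) (𝓝 (E c)) := by
    intro c hc
    have h1 := hc.tendsto_slope_zero
    have h2 : Tendsto (fun h : ℝ => -h) (𝓝[>] 0) (𝓝[≠] 0) := by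
      refine tendsto_nhdsWithin_iff.2 ⟨?_, ?_⟩
      · have : Tendsto (fun h : ℝ => -h) (𝓝 0) (𝓝 (-0)) := tendsto_id.neg
        rw [neg_zero] at this
        exact this.mono_left nhdsWithin_le_nhds
      · filter_upwards [self_mem_nhdsWithin] with h hh
        have : (0:ℝ) < h := hh
        simp [this.ne']
    refine (h1.comp h2).congr fun h => ?_
    have := intervalIntegral.integral_interval_sub_left (hI 0 c) (hI 0 (c - h))
    simp only [Function.comp, smul_eq_mul, ← this]
    rw [← sub_eq_add_neg, inv_neg]
    ring
  refine ((key b hb).sub (key a ha)).congr fun h => ?_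
  rw [intervalIntegral.integral_sub (hI a b) (locallyIntegrable_comp_sub hE h a b),
    intervalIntegral.integral_comp_sub_right (fun t => E t)]
  have h1 := intervalIntegral.integral_add_adjacent_intervals (hI (a - h) a) (hI a b)
  have h2 := intervalIntegral.integral_add_adjacent_intervals (hI (a - h) (b - h)) (hI (b - h) b)
  rw [← mul_sub]
  congr 1
  linarith

/-- Steklov averages converge in the mean. -/
theorem tendsto_integral_steklov {ρ : ℝ → ℝ} (hρ : LocallyIntegrable ρ) (a b : ℝ) :
    Tendsto (fun h => h⁻¹ * ∫ t in a..b, ∫ s in (t - h)..t, ρ s) (𝓝[>] 0)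
      (𝓝 (∫ t in a..b, ρ t)) := by
  have hI := intervalIntegrable_of_locallyIntegrable hρ
  have hc : Continuous (fun x => ∫ t in (0:ℝ)..x, ρ t) :=
    intervalIntegral.continuous_primitive hI 0
  have hd : ∀ c, HasDerivAt (fun x => ∫ t in (0:ℝ)..x, ∫ s in (0:ℝ)..t, ρ s)
      (∫ s in (0:ℝ)..c, ρ s) c := fun c =>
    intervalIntegral.integral_hasDerivAt_right (hc.intervalIntegrable _ _)
      hc.stronglyMeasurable.stronglyMeasurableAtFilter hc.continuousAt
  have := tendsto_integral_backward_difference (hc.locallyIntegrable) (hd a) (hd b)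
  rw [intervalIntegral.integral_interval_sub_left (hI 0 b) (hI 0 a)] at this
  refine this.congr fun h => ?_
  congr 1
  refine intervalIntegral.integral_congr fun t _ => ?_
  exact intervalIntegral.integral_interval_sub_left (hI 0 t) (hI 0 (t - h))

variable {X : Type*} [NormedAddCommGroup X] [InnerProductSpace ℝ X] [CompleteSpace X]

/-- The Cauchy-Schwarz inequality for an interval integral. -/
theorem norm_integral_sq_le {f : ℝ → X} {s t : ℝ} (hst : s ≤ t)
    (hf : IntervalIntegrable f volume s t)
    (hf2 : IntervalIntegrable (fun x => ‖f x‖ ^ 2) volume s t) :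
    ‖∫ x in s..t, f x‖ ^ 2 ≤ (t - s) * ∫ x in s..t, ‖f x‖ ^ 2 := by
  rcases hst.eq_or_lt with rfl | hlt
  · simp
  set q := ∫ x in s..t, f x with hq
  have hpos : 0 < t - s := sub_pos.2 hlt
  have h0 : ∫ x in s..t, ⟪q, f x⟫ = ‖q‖ ^ 2 := by
    rw [intervalIntegral.integral_of_le hst, integral_inner (hf.1) q,
      ← intervalIntegral.integral_of_le hst, ← hq, real_inner_self_eq_norm_sq]
  have hin : IntervalIntegrable (fun x => ⟪q, f x⟫) volume s t :=
    ⟨hf.1.const_inner q, hf.2.const_inner q⟩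
  have h1 : ∫ x in s..t, ⟪q, f x⟫ ≤
      ∫ x in s..t, (‖q‖ ^ 2 / (2 * (t - s)) + (t - s) / 2 * ‖f x‖ ^ 2) := by
    refine intervalIntegral.integral_mono_on hst hin
      (intervalIntegrable_const.add (hf2.const_mul _)) fun x _ => ?_
    have h2 : ⟪q, f x⟫ ≤ ‖q‖ * ‖f x‖ := real_inner_le_norm _ _
    have h3 : 0 ≤ (‖q‖ - (t - s) * ‖f x‖) ^ 2 / (2 * (t - s)) := by positivity
    have h4 : (‖q‖ - (t - s) * ‖f x‖) ^ 2 / (2 * (t - s)) =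
      ‖q‖ ^ 2 / (2 * (t - s)) + (t - s) / 2 * ‖f x‖ ^ 2 - ‖q‖ * ‖f x‖ := by
      field_simp; ring
    linarith
  rw [intervalIntegral.integral_add intervalIntegrable_const (hf2.const_mul _),
    intervalIntegral.integral_const, intervalIntegral.integral_const_mul, h0, smul_eq_mul] at h1
  have h5 : (t - s) * (‖q‖ ^ 2 / (2 * (t - s))) = ‖q‖ ^ 2 / 2 := by field_simp
  rw [h5] at h1
  linarith

/-- Lower semicontinuity of the dissipation along backward Steklov averages. -/
theorem integral_norm_sq_le_liminf_steklov {f : ℝ → X} (hf : LocallyIntegrable f)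
    (hf2 : LocallyIntegrable (fun t => ‖f t‖ ^ 2)) {a b : ℝ} (hab : a ≤ b) {h : ℕ → ℝ}
    (hh : ∀ n, 0 < h n) (hlim : Tendsto h atTop (𝓝 0)) {c : ℝ}
    (hc : c < ∫ t in a..b, ‖f t‖ ^ 2) :
    ∀ᶠ n in atTop, c < (h n)⁻¹ * ∫ t in a..b, ⟪f t, ∫ s in (t - h n)..t, f s⟫ := by
  have hI := intervalIntegrable_of_locallyIntegrable hf
  have hI2 := intervalIntegrable_of_locallyIntegrable hf2
  have hlim' : Tendsto h atTop (𝓝[>] 0) :=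
    tendsto_nhdsWithin_iff.2 ⟨hlim, Eventually.of_forall hh⟩
  set q : ℕ → ℝ → X := fun n t => ∫ s in (t - h n)..t, f s with hqdef
  set A : ℕ → ℝ → ℝ := fun n t => ∫ s in (t - h n)..t, ‖f s‖ ^ 2 with hAdef
  have hA : Tendsto (fun n => (h n)⁻¹ * ∫ t in a..b, A n t) atTop
      (𝓝 (∫ t in a..b, ‖f t‖ ^ 2)) := (tendsto_integral_steklov hf2 a b).comp hlim'
  have hfsm : AEStronglyMeasurable f volume := hf.aestronglyMeasurable
  have hinner : ∀ n, IntervalIntegrable (fun t => ⟪f t, q n t⟫) volume a b := by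
    intro n
    have hb : Bornology.IsBounded ((q n) '' Icc a b) :=
      (isCompact_Icc.image (continuous_steklov hf (h n))).isBounded
    obtain ⟨K, hK⟩ := hb.exists_norm_le
    refine IntervalIntegrable.mono_fun' ((hI a b).norm.mul_const K)
      ((hfsm.inner (continuous_steklov hf (h n)).aestronglyMeasurable).restrict) ?_
    refine (ae_restrict_iff' measurableSet_uIoc).2 (Eventually.of_forall fun t ht => ?_)
    rw [uIoc_of_le hab] at ht
    refine (norm_inner_le_norm _ _).trans ?_
    exact mul_le_mul_of_nonneg_left (hK _ ⟨t, ⟨ht.1.le, ht.2⟩, rfl⟩) (norm_nonneg _)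
  set G : ℕ → ℝ → ℝ := fun n t =>
    (h n)⁻¹ * ⟪f t, q n t⟫ + ((1/2) * ‖f t‖ ^ 2 + (1/2) * ((h n)⁻¹ * A n t)) with hGdef
  have hAi : ∀ n, IntervalIntegrable (A n) volume a b := fun n =>
    (continuous_steklov hf2 (h n)).intervalIntegrable _ _
  have hGi : ∀ n, IntervalIntegrable (G n) volume a b := fun n =>
    ((hinner n).const_mul _).add (((hI2 a b).const_mul _).add (((hAi n).const_mul _).const_mul _))
  have hGint : ∀ n, ∫ t in a..b, G n t = (h n)⁻¹ * (∫ t in a..b, ⟪f t, q n t⟫) +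
      ((1/2) * (∫ t in a..b, ‖f t‖ ^ 2) + (1/2) * ((h n)⁻¹ * ∫ t in a..b, A n t)) := by
    intro n
    simp only [hGdef]
    rw [intervalIntegral.integral_add ((hinner n).const_mul _)
      (((hI2 a b).const_mul _).add (((hAi n).const_mul _).const_mul _)),
      intervalIntegral.integral_add ((hI2 a b).const_mul _) (((hAi n).const_mul _).const_mul _)]
    simp only [intervalIntegral.integral_const_mul]
  have hGnn : ∀ n t, 0 ≤ G n t := by
    intro n t
    have hle : t - h n ≤ t := by linarith [hh n]
    have h0 : ∫ x in (t - h n)..t, ⟪f t, f x⟫ = ⟪f t, q n t⟫ := by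
      rw [intervalIntegral.integral_of_le hle, integral_inner ((hI _ _).1) (f t),
        ← intervalIntegral.integral_of_le hle]
    have h1 : ∫ x in (t - h n)..t, (-(1/2) * ‖f t‖ ^ 2 + (-(1/2)) * ‖f x‖ ^ 2) ≤
        ∫ x in (t - h n)..t, ⟪f t, f x⟫ := by
      refine intervalIntegral.integral_mono_on hle
        (intervalIntegrable_const.add ((hI2 _ _).const_mul _))
        ⟨(hI _ _).1.const_inner (f t), (hI _ _).2.const_inner (f t)⟩ fun x _ => ?_
      have h2 := abs_le.1 (abs_real_inner_le_norm (f t) (f x))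
      nlinarith [sq_nonneg (‖f t‖ - ‖f x‖)]
    rw [intervalIntegral.integral_add intervalIntegrable_const ((hI2 _ _).const_mul _),
      intervalIntegral.integral_const, intervalIntegral.integral_const_mul, h0, smul_eq_mul] at h1
    have h3 := mul_le_mul_of_nonneg_left h1 (inv_nonneg.2 (hh n).le)
    have h4 : (h n)⁻¹ * ((t - (t - h n)) * (-(1/2) * ‖f t‖ ^ 2) +
        -(1/2) * ∫ x in (t - h n)..t, ‖f x‖ ^ 2) =
        -(1/2) * ‖f t‖ ^ 2 - (1/2) * ((h n)⁻¹ * A n t) := by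
      have := (hh n).ne'
      simp only [hAdef]
      field_simp
      ring
    simp only [hGdef]
    linarith
  have hder : ∀ᵐ t, Tendsto (fun n => G n t) atTop (𝓝 (2 * ‖f t‖ ^ 2)) := by
    filter_upwards [_root_.LocallyIntegrable.ae_hasDerivAt_integral hf,
      _root_.LocallyIntegrable.ae_hasDerivAt_integral hf2] with t h1 h2
    have hneg : Tendsto (fun n => -h n) atTop (𝓝[≠] 0) := by
      refine tendsto_nhdsWithin_iff.2 ⟨by simpa using hlim.neg, Eventually.of_forall fun n => ?_⟩
      simp [(hh n).ne']
    have e1 : Tendsto (fun n => (h n)⁻¹ • q n t) atTop (𝓝 (f t)) := by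
      refine ((h1 0).tendsto_slope_zero.comp hneg).congr fun n => ?_
      have := intervalIntegral.integral_interval_sub_left (hI 0 t) (hI 0 (t - h n))
      simp only [Function.comp, hqdef, ← this]
      rw [← sub_eq_add_neg, inv_neg, neg_smul, ← smul_neg, neg_sub]
    have e2 : Tendsto (fun n => (h n)⁻¹ * A n t) atTop (𝓝 (‖f t‖ ^ 2)) := by
      refine ((h2 0).tendsto_slope_zero.comp hneg).congr fun n => ?_
      have := intervalIntegral.integral_interval_sub_left (hI2 0 t) (hI2 0 (t - h n))
      simp only [Function.comp, hAdef, ← this, smul_eq_mul]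
      rw [← sub_eq_add_neg, inv_neg]; ring
    have e3 : Tendsto (fun n => ⟪f t, (h n)⁻¹ • q n t⟫) atTop (𝓝 ⟪f t, f t⟫) :=
      tendsto_const_nhds.inner e1
    have e4 := e3.add ((tendsto_const_nhds (x := (1/2) * ‖f t‖ ^ 2)).add (e2.const_mul (1/2)))
    rw [real_inner_self_eq_norm_sq] at e4
    have e5 : ‖f t‖ ^ 2 + (1 / 2 * ‖f t‖ ^ 2 + 1 / 2 * ‖f t‖ ^ 2) = 2 * ‖f t‖ ^ 2 := by ring
    rw [e5] at e4
    refine e4.congr fun n => ?_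
    simp only [hGdef, real_inner_smul_right]
  have hofReal : ∀ F : ℝ → ℝ, IntervalIntegrable F volume a b → (∀ t, 0 ≤ F t) →
      ∫⁻ t in Ioc a b, ENNReal.ofReal (F t) = ENNReal.ofReal (∫ t in a..b, F t) := by
    intro F hF hF0
    rw [intervalIntegral.integral_of_le hab]
    exact (ofReal_integral_eq_lintegral_ofReal hF.1 (Eventually.of_forall hF0)).symm
  have hfat : ENNReal.ofReal (2 * ∫ t in a..b, ‖f t‖ ^ 2) ≤
      liminf (fun n => ENNReal.ofReal (∫ t in a..b, G n t)) atTop := by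
    rw [← intervalIntegral.integral_const_mul, ← hofReal (fun t => 2 * ‖f t‖ ^ 2)
      ((hI2 a b).const_mul _) (fun t => by positivity)]
    have h1 : ∫⁻ t in Ioc a b, ENNReal.ofReal (2 * ‖f t‖ ^ 2) =
        ∫⁻ t in Ioc a b, liminf (fun n => ENNReal.ofReal (G n t)) atTop := by
      refine lintegral_congr_ae (ae_restrict_of_ae ?_)
      filter_upwards [hder] with t ht
      exact ((ENNReal.continuous_ofReal.tendsto _).comp ht).liminf_eq.symm
    rw [h1]
    simp only [← hofReal _ (hGi _) (hGnn _)]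
    exact lintegral_liminf_le' fun n => (hGi n).1.aestronglyMeasurable.aemeasurable.ennreal_ofReal
  set D := ∫ t in a..b, ‖f t‖ ^ 2 with hD
  have hDnn : 0 ≤ D := intervalIntegral.integral_nonneg hab fun t _ => by positivity
  rcases lt_or_ge (D + c) 0 with hneg | hnn
  · have hA' := hA.const_mul (1/2 : ℝ)
    have : ∀ᶠ n in atTop, (1/2 : ℝ) * ((h n)⁻¹ * ∫ t in a..b, A n t) < (1/2) * D + (-(D+c)) :=
      hA'.eventually_lt_const (by linarith)
    filter_upwards [this] with n hn
    have h1 : 0 ≤ ∫ t in a..b, G n t := intervalIntegral.integral_nonneg hab fun t _ => hGnn n t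
    rw [hGint] at h1
    linarith
  · obtain ⟨m, hm1, hm2⟩ := exists_between hc
    have hlt : ENNReal.ofReal (D + m) < ENNReal.ofReal (2 * D) :=
      (ENNReal.ofReal_lt_ofReal_iff (by linarith)).2 (by linarith)
    have h1 := eventually_lt_of_lt_liminf (hlt.trans_le hfat)
    have hA' := hA.const_mul (1/2 : ℝ)
    have h2 : ∀ᶠ n in atTop, (1/2 : ℝ) * ((h n)⁻¹ * ∫ t in a..b, A n t) < (1/2) * D + (m - c) :=
      hA'.eventually_lt_const (by linarith)
    filter_upwards [h1, h2] with n hn1 hn2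
    have h3 : D + m < ∫ t in a..b, G n t := by
      by_contra hcon
      exact absurd (ENNReal.ofReal_le_ofReal (not_lt.1 hcon)) (not_le.2 hn1)
    rw [hGint] at h3
    linarith

/-- Passage from a one-sided increment inequality to an integrated energy inequality. -/
theorem energy_inequality_of_increments {E ρ : ℝ → ℝ} {f g : ℝ → X} {C : ℝ}
    (hE : LocallyIntegrable E) (hρ : LocallyIntegrable ρ)
    (hf : LocallyIntegrable f) (hf2 : LocallyIntegrable (fun t => ‖f t‖ ^ 2))
    (hg : LocallyIntegrable g) (hg2 : LocallyIntegrable (fun t => ‖g t‖ ^ 2))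
    (hC : 0 ≤ C) {a₀ b₀ : ℝ} {S : Set ℝ} (hS : ∀ᵐ t, t ∈ S)
    (hinc : ∀ s ∈ S, ∀ t ∈ S, a₀ < s → s < t → t < b₀ →
      E t - E s ≤ -⟪f t, ∫ x in s..t, f x⟫ - ⟪g t, ∫ x in s..t, g x⟫
        + C * ‖∫ x in s..t, f x‖ ^ 2 + ∫ x in s..t, ρ x) :
    ∀ᵐ a, ∀ᵐ b, a₀ < a → a < b → b < b₀ →
      E b + (∫ t in a..b, ‖f t‖ ^ 2) + (∫ t in a..b, ‖g t‖ ^ 2) ≤ E a + ∫ t in a..b, ρ t := by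
  have hder := _root_.LocallyIntegrable.ae_hasDerivAt_integral hE
  filter_upwards [hder] with a ha
  filter_upwards [hder] with b hb ha0 hab hb0
  have ha := ha 0
  have hb := hb 0
  have hIf := intervalIntegrable_of_locallyIntegrable hf
  have hIf2 := intervalIntegrable_of_locallyIntegrable hf2
  have hIg := intervalIntegrable_of_locallyIntegrable hg
  have hIρ := intervalIntegrable_of_locallyIntegrable hρ
  have hIE := intervalIntegrable_of_locallyIntegrable hE
  obtain ⟨h, -, hh0, hhlim⟩ := exists_seq_strictAnti_tendsto' (x := (0:ℝ)) (y := a - a₀)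
    (by linarith)
  have hhpos : ∀ n, 0 < h n := fun n => (hh0 n).1
  have hlim' : Tendsto h atTop (𝓝[>] 0) :=
    tendsto_nhdsWithin_iff.2 ⟨hhlim, Eventually.of_forall hhpos⟩
  have hinner : ∀ {k : ℝ → X}, LocallyIntegrable k → ∀ δ : ℝ,
      IntervalIntegrable (fun t => ⟪k t, ∫ s in (t - δ)..t, k s⟫) volume a b := by
    intro k hk δ
    obtain ⟨K, hK⟩ :=
      (isCompact_Icc.image (continuous_steklov hk δ)).isBounded.exists_norm_le (s := _ '' Icc a b)
    refine IntervalIntegrable.mono_fun'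
      ((intervalIntegrable_of_locallyIntegrable hk a b).norm.mul_const K)
      ((hk.aestronglyMeasurable.inner (continuous_steklov hk δ).aestronglyMeasurable).restrict) ?_
    refine (ae_restrict_iff' measurableSet_uIoc).2 (Eventually.of_forall fun t ht => ?_)
    rw [uIoc_of_le hab.le] at ht
    refine (norm_inner_le_norm _ _).trans ?_
    exact mul_le_mul_of_nonneg_left (hK _ ⟨t, ⟨ht.1.le, ht.2⟩, rfl⟩) (norm_nonneg _)
  have hmain : ∀ n, (h n)⁻¹ * (∫ t in a..b, (E t - E (t - h n))) ≤
      -((h n)⁻¹ * ∫ t in a..b, ⟪f t, ∫ s in (t - h n)..t, f s⟫)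
      - ((h n)⁻¹ * ∫ t in a..b, ⟪g t, ∫ s in (t - h n)..t, g s⟫)
      + C * h n * ((h n)⁻¹ * ∫ t in a..b, ∫ s in (t - h n)..t, ‖f s‖ ^ 2)
      + (h n)⁻¹ * ∫ t in a..b, ∫ s in (t - h n)..t, ρ s := by
    intro n
    have hshift : ∀ᵐ t, t - h n ∈ S :=
      (measurePreserving_sub_right volume (h n)).quasiMeasurePreserving.ae hS
    have i1 := hinner hf (h n)
    have i1n : IntervalIntegrable (fun t => -⟪f t, ∫ s in (t - h n)..t, f s⟫) volume a b := i1.neg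
    have i2 := hinner hg (h n)
    have i3 : IntervalIntegrable (fun t => ∫ s in (t - h n)..t, ‖f s‖ ^ 2) volume a b :=
      (continuous_steklov hf2 (h n)).intervalIntegrable _ _
    have i4 : IntervalIntegrable (fun t => ∫ s in (t - h n)..t, ρ s) volume a b :=
      (continuous_steklov hρ (h n)).intervalIntegrable _ _
    have hle : (∫ t in a..b, (E t - E (t - h n))) ≤
        ∫ t in a..b, (-⟪f t, ∫ s in (t - h n)..t, f s⟫ - ⟪g t, ∫ s in (t - h n)..t, g s⟫
          + C * h n * (∫ s in (t - h n)..t, ‖f s‖ ^ 2) + ∫ s in (t - h n)..t, ρ s) := by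
      refine intervalIntegral.integral_mono_ae_restrict hab.le
        ((hIE a b).sub (locallyIntegrable_comp_sub hE _ a b))
        (((i1n.sub i2).add (i3.const_mul _)).add i4) ?_
      have hbne : ∀ᵐ t : ℝ, t ≠ b := by simp [ae_iff, measure_singleton]
      have hane : ∀ᵐ t : ℝ, t ≠ a := by simp [ae_iff, measure_singleton]
      refine (ae_restrict_iff' measurableSet_Icc).2 ?_
      filter_upwards [hS, hshift, hbne, hane] with t h1 h2 h3 h4 ht
      have hlt : t - h n < t := by linarith [hhpos n]
      have e := hinc _ h2 _ h1 (by linarith [(hh0 n).2, ht.1]) hlt (by linarith [ht.2])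
      have e2 := norm_integral_sq_le hlt.le (hIf (t - h n) t) (hIf2 (t - h n) t)
      rw [_root_.sub_sub_cancel] at e2
      have e3 := mul_le_mul_of_nonneg_left e2 hC
      rw [← mul_assoc] at e3
      linarith
    rw [intervalIntegral.integral_add ((i1n.sub i2).add (i3.const_mul _)) i4,
      intervalIntegral.integral_add (i1n.sub i2) (i3.const_mul _),
      intervalIntegral.integral_sub i1n i2, intervalIntegral.integral_neg,
      intervalIntegral.integral_const_mul] at hle
    have := mul_le_mul_of_nonneg_left hle (inv_nonneg.2 (hhpos n).le)
    refine this.trans (le_of_eq ?_)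
    ring
  have l1 := (tendsto_integral_backward_difference hE ha hb).comp hlim'
  have l2 := ((hhlim.const_mul C).mul ((tendsto_integral_steklov hf2 a b).comp hlim'))
  have l3 := (tendsto_integral_steklov hρ a b).comp hlim'
  rw [mul_zero, zero_mul] at l2
  refine le_of_forall_pos_le_add fun ε hε => ?_
  have d1 := integral_norm_sq_le_liminf_steklov hf hf2 hab.le hhpos hhlim
    (c := (∫ t in a..b, ‖f t‖ ^ 2) - ε / 2) (by linarith)
  have d2 := integral_norm_sq_le_liminf_steklov hg hg2 hab.le hhpos hhlim
    (c := (∫ t in a..b, ‖g t‖ ^ 2) - ε / 2) (by linarith)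
  have l4 := le_of_tendsto_of_tendsto l1 ((l2.add l3).const_add
    (-((∫ t in a..b, ‖f t‖ ^ 2) - ε / 2) - ((∫ t in a..b, ‖g t‖ ^ 2) - ε / 2))) (by
      filter_upwards [d1, d2] with n h1 h2
      have := hmain n
      simp only [Function.comp]
      linarith)
  linarith

end Averages

/-! ### Spectral powers -/

section Spectral

variable {Om : Set E3}

/-- Complete orthonormal systems. -/
def IsCompleteSystem (e : ℕ → Hs Om) : Prop :=
  Orthonormal ℝ e ∧ (Submodule.span ℝ (Set.range e)).topologicalClosure = ⊤

variable {e : ℕ → Hs Om} {lam : ℕ → ℝ} {ρ : ℝ}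

namespace IsCompleteSystem

/-- The Hilbert basis attached to a complete orthonormal system. -/
def basis (he : IsCompleteSystem e) : HilbertBasis ℕ ℝ (Hs Om) :=
  HilbertBasis.mk he.1 he.2.ge

theorem coe_basis (he : IsCompleteSystem e) : (he.basis : ℕ → Hs Om) = e :=
  HilbertBasis.coe_mk _ _

theorem hasSum_sq (he : IsCompleteSystem e) (v : Hs Om) :
    HasSum (fun j => ⟪v, e j⟫ ^ 2) (‖v‖ ^ 2) := by
  have := he.basis.hasSum_inner_mul_inner v v
  rw [he.coe_basis, real_inner_self_eq_norm_sq] at this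
  refine this.congr_fun fun j => ?_
  rw [real_inner_comm v (e j), sq]

theorem ext (he : IsCompleteSystem e) {v w : Hs Om} (h : ∀ j, ⟪v, e j⟫ = ⟪w, e j⟫) : v = w := by
  have := he.hasSum_sq (v - w)
  have h0 : (fun j => ⟪v - w, e j⟫ ^ 2) = fun _ => (0:ℝ) := by
    ext1 j; rw [inner_sub_left, h j, sub_self]; norm_num
  rw [h0] at this
  have := this.unique hasSum_zero
  rw [sq_eq_zero_iff, norm_eq_zero, sub_eq_zero] at this
  exact this

theorem hasSum_fracPow (he : IsCompleteSystem e) {v : Hs Om} (hv : inDom lam e ρ v) :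
    HasSum (fun j => ((lam j) ^ ρ * ⟪v, e j⟫) • e j) (fracPow lam e ρ v) := by
  have hmem : Memℓp (fun j => (lam j) ^ ρ * ⟪v, e j⟫) 2 := by
    apply memℓp_gen
    refine hv.congr fun j => ?_
    simp [mul_pow]
  have := he.basis.hasSum_repr_symm ⟨_, hmem⟩
  rw [he.coe_basis] at this
  exact this.summable.hasSum

theorem inner_basis (he : IsCompleteSystem e) (i j : ℕ) :
    ⟪e i, e j⟫ = if i = j then (1:ℝ) else 0 := orthonormal_iff_ite.1 he.1 i j

theorem inner_fracPow (he : IsCompleteSystem e) {v : Hs Om} (hv : inDom lam e ρ v) (j : ℕ) :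
    ⟪fracPow lam e ρ v, e j⟫ = (lam j) ^ ρ * ⟪v, e j⟫ := by
  have h := (he.hasSum_fracPow hv).mapL (innerSL ℝ (e j))
  have h2 : HasSum (fun i => (innerSL ℝ (e j)) (((lam i) ^ ρ * ⟪v, e i⟫) • e i))
      ((lam j) ^ ρ * ⟪v, e j⟫) := by
    convert hasSum_ite_eq j ((lam j) ^ ρ * ⟪v, e j⟫) using 1
    ext1 i
    rw [innerSL_apply_apply, real_inner_smul_right, he.inner_basis]
    by_cases hij : i = j
    · subst hij; simp
    · simp [hij, Ne.symm hij]
  have := h.unique h2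
  rw [innerSL_apply_apply, real_inner_comm] at this
  exact this

theorem hasSum_norm_sq_fracPow (he : IsCompleteSystem e) {v : Hs Om} (hv : inDom lam e ρ v) :
    HasSum (fun j => ((lam j) ^ ρ * ⟪v, e j⟫) ^ 2) (‖fracPow lam e ρ v‖ ^ 2) := by
  have := he.hasSum_sq (fracPow lam e ρ v)
  simpa only [he.inner_fracPow hv] using this

end IsCompleteSystem

theorem inDom_add {v w : Hs Om} (hv : inDom lam e ρ v) (hw : inDom lam e ρ w) :
    inDom lam e ρ (v + w) := by
  refine Summable.of_nonneg_of_le (fun _ => sq_nonneg _) (fun j => ?_)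
    ((hv.mul_left 2).add (hw.mul_left 2))
  rw [inner_add_left]
  nlinarith [sq_nonneg ((lam j) ^ ρ * ⟪v, e j⟫ - (lam j) ^ ρ * ⟪w, e j⟫)]

theorem inDom_smul {v : Hs Om} (c : ℝ) (hv : inDom lam e ρ v) : inDom lam e ρ (c • v) := by
  refine (hv.mul_left (c ^ 2)).congr fun j => ?_
  rw [real_inner_smul_left]; ring

theorem inDom_sub {v w : Hs Om} (hv : inDom lam e ρ v) (hw : inDom lam e ρ w) :
    inDom lam e ρ (v - w) := by
  have := inDom_add hv (inDom_smul (-1) hw)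
  rwa [neg_one_smul, ← sub_eq_add_neg] at this

/-- The domain of a spectral power as a subspace. -/
def domSubmodule (lam : ℕ → ℝ) (e : ℕ → Hs Om) (ρ : ℝ) : Submodule ℝ (Hs Om) where
  carrier := {v | inDom lam e ρ v}
  add_mem' := inDom_add
  zero_mem' := by simp [inDom, summable_zero]
  smul_mem' c _ hv := inDom_smul c hv

theorem IsCompleteSystem.inDom_basis (he : IsCompleteSystem e) (k : ℕ) :
    inDom lam e ρ (e k) := by
  refine summable_of_ne_finset_zero (s := {k}) fun j hj => ?_
  have hj' : k ≠ j := fun h => hj (by simp [h])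
  simp [he.inner_basis, hj']

theorem IsCompleteSystem.dense_inDom (he : IsCompleteSystem e) :
    Dense {v : Hs Om | inDom lam e ρ v} := by
  have h1 : Submodule.span ℝ (Set.range e) ≤ domSubmodule lam e ρ := by
    rw [Submodule.span_le]
    rintro _ ⟨k, rfl⟩
    exact he.inDom_basis k
  have h2 : Dense (Submodule.span ℝ (Set.range e) : Set (Hs Om)) :=
    Submodule.dense_iff_topologicalClosure_eq_top.2 he.2
  exact h2.mono h1

theorem IsCompleteSystem.fracPow_sub (he : IsCompleteSystem e) {v w : Hs Om}
    (hv : inDom lam e ρ v) (hw : inDom lam e ρ w) :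
    fracPow lam e ρ (v - w) = fracPow lam e ρ v - fracPow lam e ρ w := by
  refine he.ext fun j => ?_
  rw [inner_sub_left, he.inner_fracPow (inDom_sub hv hw), he.inner_fracPow hv, he.inner_fracPow hw,
    inner_sub_left]
  ring

/-- The spectral energy `‖A^ρ v‖²`, with value `∞` outside of the domain. -/
def specEnergy (lam : ℕ → ℝ) (e : ℕ → Hs Om) (ρ : ℝ) (v : Hs Om) : ℝ≥0∞ :=
  ∑' j, ENNReal.ofReal (((lam j) ^ ρ * ⟪v, e j⟫) ^ 2)

theorem inDom_iff_specEnergy_ne_top {v : Hs Om} :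
    inDom lam e ρ v ↔ specEnergy lam e ρ v ≠ ⊤ := by
  refine ⟨fun h => h.tsum_ofReal_ne_top, fun h => ?_⟩
  refine (ENNReal.summable_toReal h).congr fun j => ?_
  rw [ENNReal.toReal_ofReal (sq_nonneg _)]

theorem IsCompleteSystem.specEnergy_eq (he : IsCompleteSystem e) {v : Hs Om}
    (hv : inDom lam e ρ v) :
    specEnergy lam e ρ v = ENNReal.ofReal (‖fracPow lam e ρ v‖ ^ 2) := by
  rw [← (he.hasSum_norm_sq_fracPow hv).tsum_eq,
    ENNReal.ofReal_tsum_of_nonneg (fun _ => sq_nonneg _) hv]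
  rfl

theorem IsCompleteSystem.specEnergy_zero (he : IsCompleteSystem e) (v : Hs Om) :
    specEnergy lam e 0 v = ENNReal.ofReal (‖v‖ ^ 2) := by
  rw [← (he.hasSum_sq v).tsum_eq,
    ENNReal.ofReal_tsum_of_nonneg (fun _ => sq_nonneg _) (he.hasSum_sq v).summable]
  simp [specEnergy]

theorem lowerSemicontinuous_specEnergy : LowerSemicontinuous (specEnergy lam e ρ) := by
  refine lowerSemicontinuous_tsum fun j => Continuous.lowerSemicontinuous ?_
  exact ENNReal.continuous_ofReal.comp (by fun_prop)

/-- Weak lower semicontinuity of the spectral energy along coefficientwise convergence. -/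
theorem specEnergy_le_of_tendsto {ι : Type*} {l : Filter ι} [l.NeBot] {v : ι → Hs Om} {w : Hs Om}
    (hlim : ∀ j, Tendsto (fun n => ⟪v n, e j⟫) l (𝓝 ⟪w, e j⟫)) {C : ℝ≥0∞}
    (hC : ∀ᶠ n in l, specEnergy lam e ρ (v n) ≤ C) : specEnergy lam e ρ w ≤ C := by
  rw [specEnergy, ENNReal.tsum_eq_iSup_sum]
  refine iSup_le fun s => ?_
  have ht : Tendsto (fun n => ∑ j ∈ s, ENNReal.ofReal (((lam j) ^ ρ * ⟪v n, e j⟫) ^ 2)) l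
      (𝓝 (∑ j ∈ s, ENNReal.ofReal (((lam j) ^ ρ * ⟪w, e j⟫) ^ 2))) :=
    tendsto_finsetSum _ fun j _ =>
      (ENNReal.continuous_ofReal.tendsto _).comp (((hlim j).const_mul _).pow 2)
  refine le_of_tendsto ht ?_
  filter_upwards [hC] with n hn
  exact (ENNReal.sum_le_tsum s).trans hn

/-- An Ehrling-type estimate for the components of an element `δ` with `δ = -A^r q`. -/
theorem IsCompleteSystem.abs_inner_le (he : IsCompleteSystem e) (p : Hs Om) {η : ℝ} (hη : 0 < η) :
    ∃ C : ℝ, 0 ≤ C ∧ ∀ δ q : Hs Om,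
      (∀ v, inDom lam e ρ v → ⟪δ, v⟫ = -⟪q, fracPow lam e ρ v⟫) →
      |⟪δ, p⟫| ≤ η * ‖δ‖ + C * ‖q‖ := by
  obtain ⟨p', hp', hd⟩ := Metric.dense_iff.1 (he.dense_inDom (lam := lam) (ρ := ρ)) p η hη
  refine ⟨‖fracPow lam e ρ p'‖, norm_nonneg _, fun δ q h => ?_⟩
  have h1 : ⟪δ, p⟫ = ⟪δ, p - p'⟫ + -⟪q, fracPow lam e ρ p'⟫ := by
    rw [← h p' hd, ← inner_add_right, sub_add_cancel]
  have h2 : ‖p - p'‖ ≤ η := by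
    rw [Metric.mem_ball, dist_comm, dist_eq_norm] at hp'; exact hp'.le
  rw [h1]
  refine (abs_add_le _ _).trans (add_le_add ?_ ?_)
  · refine (abs_real_inner_le_norm _ _).trans ?_
    rw [mul_comm]
    exact mul_le_mul_of_nonneg_right h2 (norm_nonneg _)
  · rw [abs_neg, mul_comm]
    exact abs_real_inner_le_norm _ _

/-- Low frequencies control the norm up to a small multiple of the spectral energy. -/
theorem IsCompleteSystem.norm_sq_le_sum_add (he : IsCompleteSystem e)
    (hlam : Tendsto lam atTop atTop) (hρ : 0 < ρ) {ε : ℝ} (hε : 0 < ε) :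
    ∃ N : ℕ, ∀ v : Hs Om, inDom lam e ρ v →
      ‖v‖ ^ 2 ≤ ε * ‖fracPow lam e ρ v‖ ^ 2 + ∑ j ∈ Finset.range N, ⟪v, e j⟫ ^ 2 := by
  have ht : Tendsto (fun j => (lam j) ^ ρ) atTop atTop := (_root_.tendsto_rpow_atTop hρ).comp hlam
  obtain ⟨N, hN⟩ := eventually_atTop.1 (ht.eventually_ge_atTop (max 1 ε⁻¹))
  refine ⟨N, fun v hv => ?_⟩
  have h1 := (he.hasSum_norm_sq_fracPow hv).mul_left ε
  have h2 : HasSum (fun j => if j ∈ Finset.range N then ⟪v, e j⟫ ^ 2 else 0)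
      (∑ j ∈ Finset.range N, ⟪v, e j⟫ ^ 2) := by
    have h3 : HasSum (fun j => if j ∈ Finset.range N then ⟪v, e j⟫ ^ 2 else 0)
        (∑ j ∈ Finset.range N, if j ∈ Finset.range N then ⟪v, e j⟫ ^ 2 else 0) :=
      hasSum_sum_of_ne_finset_zero fun j hj => if_neg hj
    rwa [Finset.sum_congr rfl fun j hj => if_pos hj] at h3
  refine hasSum_le (fun j => ?_) (he.hasSum_sq v) (h1.add h2)
  by_cases hj : j < N
  · have : 0 ≤ ε * ((lam j) ^ ρ * ⟪v, e j⟫) ^ 2 := by positivity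
    simp only [Finset.mem_range, hj, if_true]
    linarith
  · simp only [Finset.mem_range, hj, if_false, add_zero]
    have h3 := hN j (not_lt.1 hj)
    have h4 : 1 ≤ (lam j) ^ ρ := (le_max_left _ _).trans h3
    have h5 : ε⁻¹ ≤ (lam j) ^ ρ := (le_max_right _ _).trans h3
    have h6 : 1 ≤ ε * (lam j) ^ ρ := by
      have := mul_le_mul_of_nonneg_left h5 hε.le
      rwa [mul_inv_cancel₀ hε.ne'] at this
    have h7 : 1 ≤ ε * ((lam j) ^ ρ) ^ 2 := by nlinarith
    rw [mul_pow, ← mul_assoc]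
    nlinarith [sq_nonneg ⟪v, e j⟫]

/-- The Ehrling inequality between two spectral scales. -/
theorem ehrling {eA eB : ℕ → Hs Om} {lamA lamB : ℕ → ℝ} {r σ : ℝ} (heA : IsCompleteSystem eA)
    (heB : IsCompleteSystem eB) (hlam : Tendsto lamB atTop atTop) (hσ : 0 < σ) {ε : ℝ}
    (hε : 0 < ε) :
    ∃ C : ℝ, 0 ≤ C ∧ ∀ δ q : Hs Om, inDom lamB eB σ δ →
      (∀ v, inDom lamA eA r v → ⟪δ, v⟫ = -⟪q, fracPow lamA eA r v⟫) →
      ‖δ‖ ^ 2 ≤ ε * (‖δ‖ ^ 2 + ‖fracPow lamB eB σ δ‖ ^ 2) + C * ‖q‖ ^ 2 := by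
  obtain ⟨N, hN⟩ := heB.norm_sq_le_sum_add hlam hσ hε
  have hη : 0 < √(ε / (2 * (N + 1))) := Real.sqrt_pos.2 (by positivity)
  choose K hK0 hK using fun j => heA.abs_inner_le (lam := lamA) (ρ := r) (eB j) hη
  refine ⟨∑ j ∈ Finset.range N, 2 * K j ^ 2,
    Finset.sum_nonneg fun j _ => by positivity, fun δ q hδ h => ?_⟩
  have h1 : ∀ j ∈ Finset.range N,
      ⟪δ, eB j⟫ ^ 2 ≤ ε / (N + 1) * ‖δ‖ ^ 2 + 2 * K j ^ 2 * ‖q‖ ^ 2 := by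
    intro j _
    have h2 := hK j δ q h
    have h3 : ⟪δ, eB j⟫ ^ 2 ≤ (√(ε / (2 * (N + 1))) * ‖δ‖ + K j * ‖q‖) ^ 2 := by
      rw [← sq_abs]; exact pow_le_pow_left₀ (abs_nonneg _) h2 2
    have h4 : √(ε / (2 * (N + 1))) ^ 2 = ε / (2 * (N + 1)) := Real.sq_sqrt (by positivity)
    have h5 : ε / (N + 1) = 2 * √(ε / (2 * (N + 1))) ^ 2 := by rw [h4]; field_simp
    rw [h5]
    nlinarith [sq_nonneg (√(ε / (2 * (N + 1))) * ‖δ‖ - K j * ‖q‖)]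
  have h2 := Finset.sum_le_sum h1
  rw [Finset.sum_add_distrib, Finset.sum_const, ← Finset.sum_mul, Finset.card_range,
    nsmul_eq_mul] at h2
  have h3 : (N:ℝ) * (ε / (N + 1) * ‖δ‖ ^ 2) ≤ ε * ‖δ‖ ^ 2 := by
    have : (N:ℝ) * (ε / (N + 1)) ≤ ε := by
      rw [mul_div_assoc', div_le_iff₀ (by positivity)]
      nlinarith
    rw [← mul_assoc]
    exact mul_le_mul_of_nonneg_right this (sq_nonneg _)
  linarith [hN δ hδ]

/-- Coefficientwise convergence with bounded spectral energy implies strong convergence. -/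
theorem IsCompleteSystem.tendsto_of_coeff (he : IsCompleteSystem e)
    (hlam : Tendsto lam atTop atTop) (hρ : 0 < ρ) {v : ℕ → Hs Om} {w : Hs Om}
    (hv : ∀ n, inDom lam e ρ (v n)) (hw : inDom lam e ρ w) {C : ℝ}
    (hC : ∀ n, ‖fracPow lam e ρ (v n)‖ ≤ C)
    (hlim : ∀ j, Tendsto (fun n => ⟪v n, e j⟫) atTop (𝓝 ⟪w, e j⟫)) :
    Tendsto v atTop (𝓝 w) := by
  have hC0 : 0 ≤ C := (norm_nonneg _).trans (hC 0)
  set D := (C + ‖fracPow lam e ρ w‖) ^ 2 + 1 with hD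
  have hDpos : 0 < D := by positivity
  rw [tendsto_iff_norm_sub_tendsto_zero]
  have key : Tendsto (fun n => ‖v n - w‖ ^ 2) atTop (𝓝 0) := by
    refine (nhds_basis_zero_abs_lt ℝ).tendsto_right_iff.2 fun ε hε => ?_
    obtain ⟨N, hN⟩ := he.norm_sq_le_sum_add hlam hρ (ε := ε / (2 * D)) (by positivity)
    have ht : Tendsto (fun n => ∑ j ∈ Finset.range N, ⟪v n - w, e j⟫ ^ 2) atTop (𝓝 0) := by
      have : Tendsto (fun n => ∑ j ∈ Finset.range N, ⟪v n - w, e j⟫ ^ 2) atTop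
          (𝓝 (∑ j ∈ Finset.range N, (0:ℝ))) := by
        refine tendsto_finsetSum _ fun j _ => ?_
        have := ((hlim j).sub_const ⟪w, e j⟫).pow 2
        simpa [inner_sub_left] using this
      simpa using this
    filter_upwards [ht.eventually_lt_const (show (0:ℝ) < ε / 2 by linarith)] with n hn
    have h1 := hN _ (inDom_sub (hv n) hw)
    have h2 : ‖fracPow lam e ρ (v n - w)‖ ^ 2 ≤ D := by
      rw [he.fracPow_sub (hv n) hw]
      have h3 := norm_sub_le (fracPow lam e ρ (v n)) (fracPow lam e ρ w)
      have h4 := pow_le_pow_left₀ (norm_nonneg _) (h3.trans (add_le_add_left (hC n) _)) 2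
      linarith
    have h3 : ε / (2 * D) * ‖fracPow lam e ρ (v n - w)‖ ^ 2 ≤ ε / 2 := by
      refine (mul_le_mul_of_nonneg_left h2 (by positivity)).trans (le_of_eq ?_)
      field_simp
    rw [abs_of_nonneg (by positivity)]
    linarith
  have := key.sqrt
  simpa using this

/-- If the eigenvalues are bounded below by `lam 0 > 0`, the power controls the norm. -/
theorem IsCompleteSystem.norm_le_fracPow (he : IsCompleteSystem e) (hmono : Monotone lam)
    (h0 : 0 < lam 0) (hρ : 0 < ρ) {v : Hs Om} (hv : inDom lam e ρ v) :
    (lam 0) ^ ρ * ‖v‖ ≤ ‖fracPow lam e ρ v‖ := by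
  have hp : 0 < (lam 0) ^ ρ := Real.rpow_pos_of_pos h0 _
  refine le_of_sq_le_sq ?_ (norm_nonneg _)
  rw [mul_pow]
  refine hasSum_le (fun j => ?_) ((he.hasSum_sq v).mul_left _) (he.hasSum_norm_sq_fracPow hv)
  rw [mul_pow]
  refine mul_le_mul_of_nonneg_right (pow_le_pow_left₀ hp.le ?_ 2) (sq_nonneg _)
  exact Real.rpow_le_rpow h0.le (hmono (Nat.zero_le j)) hρ.le

theorem IsCompleteSystem.aestronglyMeasurable_fracPow (he : IsCompleteSystem e)
    {ν : Measure ℝ} {f : ℝ → Hs Om} (hf : AEStronglyMeasurable f ν)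
    (hd : ∀ᵐ t ∂ν, inDom lam e ρ (f t)) :
    AEStronglyMeasurable (fun t => fracPow lam e ρ (f t)) ν := by
  refine aestronglyMeasurable_of_tendsto_ae atTop
    (f := fun (n : ℕ) t => ∑ j ∈ Finset.range n, ((lam j) ^ ρ * ⟪f t, e j⟫) • e j) (fun n => ?_) ?_
  · refine Finset.aestronglyMeasurable_fun_sum _ fun j _ => ?_
    have h1 : AEStronglyMeasurable (fun t => ⟪f t, e j⟫) ν :=
      hf.inner aestronglyMeasurable_const
    exact (h1.const_mul _).smul aestronglyMeasurable_const
  · filter_upwards [hd] with t ht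
    exact (he.hasSum_fracPow ht).tendsto_sum_nat

end Spectral

/-! ### Integral functionals on `L²` -/

section Functionals

variable {Om : Set E3}

/-- The convex functional `v ↦ ∫ β̂(v)` on `L²`. -/
def convexInt (Om : Set E3) (betah : ℝ → ℝ≥0∞) (v : Hs Om) : ℝ≥0∞ :=
  ∫⁻ x, betah (v x) ∂(mOm Om)

theorem lowerSemicontinuous_convexInt {betah : ℝ → ℝ≥0∞} (hb : LowerSemicontinuous betah) :
    LowerSemicontinuous (convexInt Om betah) := by
  rw [lowerSemicontinuous_iff_isClosed_preimage]
  intro c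
  refine IsSeqClosed.isClosed fun v w hv hlim => ?_
  obtain ⟨φ, hφ, hae⟩ := (tendstoInMeasure_of_tendsto_Lp hlim).exists_seq_tendsto_ae
  have h1 : convexInt Om betah w ≤
      ∫⁻ x, liminf (fun n => betah (v (φ n) x)) atTop ∂(mOm Om) := by
    refine lintegral_mono_ae ?_
    filter_upwards [hae] with x hx
    exact le_of_forall_lt fun c hc =>
      (exists_between hc).elim fun d hd => hd.1.trans_le
        (le_liminf_of_le (by isBoundedDefault)
          ((hx.eventually (hb _ d hd.2)).mono fun _ => le_of_lt))
  refine h1.trans ((lintegral_liminf_le' fun n => ?_).trans ?_)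
  · exact hb.measurable.comp_aemeasurable (Lp.aestronglyMeasurable (v (φ n))).aemeasurable
  · refine liminf_le_of_frequently_le' (Frequently.of_forall fun n => hv (φ n))

theorem integrable_sq_coeFn (v : Hs Om) : Integrable (fun x => (v x) ^ 2) (mOm Om) := by
  simpa using (Lp.memLp v).integrable_sq

theorem integral_sq_coeFn (v : Hs Om) : ∫ x, (v x) ^ 2 ∂(mOm Om) = ‖v‖ ^ 2 := by
  rw [← real_inner_self_eq_norm_sq, L2.inner_def]
  refine integral_congr_ae (Eventually.of_forall fun x => ?_)
  simp [sq]

variable [IsFiniteMeasure (mOm Om)]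

theorem memLp_lipschitz_comp {p : ℝ → ℝ} {L : ℝ≥0} (hp : LipschitzWith L p) (v : Hs Om) :
    MemLp (fun x => p (v x)) 2 (mOm Om) := by
  have h1 : MemLp (fun x => p (v x) - p 0) 2 (mOm Om) := by
    refine (Lp.memLp v).of_le_mul (c := L)
      ((hp.continuous.comp_aestronglyMeasurable (Lp.aestronglyMeasurable v)).sub
        aestronglyMeasurable_const) (Eventually.of_forall fun x => ?_)
    simpa using hp.norm_sub_le (v x) 0
  have h2 := h1.add (memLp_const (p 0))
  refine h2.ae_eq (Eventually.of_forall fun x => ?_)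
  simp

/-- The superposition operator induced by a Lipschitz function on `L²`. -/
def superposition {p : ℝ → ℝ} {L : ℝ≥0} (hp : LipschitzWith L p) (v : Hs Om) : Hs Om :=
  (memLp_lipschitz_comp hp v).toLp _

theorem coeFn_superposition {p : ℝ → ℝ} {L : ℝ≥0} (hp : LipschitzWith L p) (v : Hs Om) :
    superposition hp v =ᵐ[mOm Om] fun x => p (v x) := MemLp.coeFn_toLp _

theorem norm_superposition_sub_le {p : ℝ → ℝ} {L : ℝ≥0} (hp : LipschitzWith L p) (v w : Hs Om) :
    ‖superposition hp v - superposition hp w‖ ≤ L * ‖v - w‖ := by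
  refine Lp.norm_le_mul_norm_of_ae_le_mul ?_
  filter_upwards [coeFn_superposition hp v, coeFn_superposition hp w,
    Lp.coeFn_sub (superposition hp v) (superposition hp w), Lp.coeFn_sub v w] with x h1 h2 h3 h4
  rw [h3, h4, Pi.sub_apply, Pi.sub_apply, h1, h2]
  exact hp.norm_sub_le _ _

theorem continuous_superposition {p : ℝ → ℝ} {L : ℝ≥0} (hp : LipschitzWith L p) :
    Continuous (superposition hp : Hs Om → Hs Om) :=
  (LipschitzWith.of_dist_le_mul (K := L) fun v w => by
    simpa only [dist_eq_norm] using norm_superposition_sub_le hp v w).continuous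

theorem integral_superposition_sub {p : ℝ → ℝ} {L : ℝ≥0} (hp : LipschitzWith L p)
    (a f v w : Hs Om) :
    ∫ x, (p (a x) - f x) * (v x - w x) ∂(mOm Om) = ⟪superposition hp a - f, v - w⟫ := by
  rw [L2.inner_def]
  refine integral_congr_ae ?_
  filter_upwards [coeFn_superposition hp a, Lp.coeFn_sub (superposition hp a) f,
    Lp.coeFn_sub v w] with x h1 h2 h3
  rw [h2, h3, Pi.sub_apply, Pi.sub_apply, h1]
  simp [mul_comm]

/-- First-order expansion of a function with Lipschitz derivative. -/
theorem abs_taylor_le {P p : ℝ → ℝ} {L : ℝ≥0} (hP : ∀ s, HasDerivAt P (p s) s)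
    (hp : LipschitzWith L p) (a b : ℝ) : |P b - P a - p a * (b - a)| ≤ L * (b - a) ^ 2 := by
  have hd : ∀ s ∈ uIcc a b, HasDerivWithinAt (fun s => P s - p a * s) (p s - p a) (uIcc a b) s :=
    fun s _ => by
      have := (hP s).sub ((hasDerivAt_id s).const_mul (p a))
      rw [mul_one] at this
      exact this.hasDerivWithinAt
  have hb : ∀ s ∈ uIcc a b, ‖p s - p a‖ ≤ L * |b - a| := fun s hs => by
    refine (hp.norm_sub_le s a).trans (mul_le_mul_of_nonneg_left ?_ L.2)
    exact abs_sub_left_of_mem_uIcc hs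
  have := (convex_uIcc a b).norm_image_sub_le_of_norm_hasDerivWithin_le hd hb
    left_mem_uIcc right_mem_uIcc
  simp only [Real.norm_eq_abs] at this
  rw [mul_assoc, ← sq, sq_abs] at this
  refine le_trans (le_of_eq ?_) this
  congr 1
  ring

/-- The smooth functional `v ↦ ∫ π̂(v)` on `L²`. -/
def smoothInt (Om : Set E3) (P : ℝ → ℝ) (v : Hs Om) : ℝ := ∫ x, P (v x) ∂(mOm Om)

variable {P p : ℝ → ℝ} {L : ℝ≥0}

theorem integrable_smooth_comp (hP : ∀ s, HasDerivAt P (p s) s) (hp : LipschitzWith L p)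
    (v : Hs Om) : Integrable (fun x => P (v x)) (mOm Om) := by
  have hc : Continuous P := continuous_iff_continuousAt.2 fun s => (hP s).continuousAt
  have hv1 : Integrable (fun x => v x) (mOm Om) := (Lp.memLp v).integrable (by norm_num)
  refine Integrable.mono' (g := fun x => |P 0| + |p 0| * |v x| + L * (v x) ^ 2)
    (((integrable_const _).add (hv1.abs.const_mul _)).add ((integrable_sq_coeFn v).const_mul _))
    (hc.comp_aestronglyMeasurable (Lp.aestronglyMeasurable v)) (Eventually.of_forall fun x => ?_)
  have h1 := abs_taylor_le hP hp 0 (v x)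
  rw [sub_zero] at h1
  have h2 : P (v x) = (P (v x) - P 0 - p 0 * v x) + (P 0 + p 0 * v x) := by ring
  rw [Real.norm_eq_abs, h2]
  have h3 := abs_add_le (P (v x) - P 0 - p 0 * v x) (P 0 + p 0 * v x)
  have h4 := abs_add_le (P 0) (p 0 * v x)
  rw [abs_mul] at h4
  linarith

theorem abs_smoothInt_sub_le (hP : ∀ s, HasDerivAt P (p s) s) (hp : LipschitzWith L p)
    (a b : Hs Om) :
    |smoothInt Om P b - smoothInt Om P a - ⟪superposition hp a, b - a⟫| ≤ L * ‖b - a‖ ^ 2 := by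
  have h1 : ⟪superposition hp a, b - a⟫ = ∫ x, p (a x) * (b x - a x) ∂(mOm Om) := by
    have := integral_superposition_sub hp a 0 b a
    rw [sub_zero] at this
    rw [← this]
    refine integral_congr_ae ?_
    filter_upwards [Lp.coeFn_zero ℝ 2 (mOm Om)] with x hx
    rw [hx]; simp
  have hab : Integrable (fun x => p (a x) * (b x - a x)) (mOm Om) :=
    (memLp_lipschitz_comp hp a).integrable_mul ((Lp.memLp b).sub (Lp.memLp a))
  have hPa := integrable_smooth_comp hP hp a
  have hPb := integrable_smooth_comp hP hp b
  have hPab : Integrable (fun x => P (b x) - P (a x)) (mOm Om) := hPb.sub hPa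
  rw [h1, smoothInt, smoothInt, ← integral_sub hPb hPa, ← integral_sub hPab hab,
    ← integral_sq_coeFn, ← integral_const_mul]
  refine (abs_integral_le_integral_abs).trans
    (integral_mono_ae (hPab.sub hab).abs ((integrable_sq_coeFn _).const_mul _) ?_)
  filter_upwards [Lp.coeFn_sub b a] with x hx
  simp only [hx, Pi.sub_apply]
  exact abs_taylor_le hP hp (a x) (b x)

theorem continuous_smoothInt (hP : ∀ s, HasDerivAt P (p s) s) (hp : LipschitzWith L p) :
    Continuous (smoothInt Om P) := by
  refine continuous_iff_continuousAt.2 fun a => ?_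
  have h1 : Tendsto (fun b : Hs Om => L * ‖b - a‖ ^ 2 + |⟪superposition hp a, b - a⟫|)
      (𝓝 a) (𝓝 0) := by
    have : Continuous (fun b : Hs Om => L * ‖b - a‖ ^ 2 + |⟪superposition hp a, b - a⟫|) := by
      fun_prop
    simpa using this.tendsto a
  rw [ContinuousAt, tendsto_iff_norm_sub_tendsto_zero]
  refine squeeze_zero (fun _ => norm_nonneg _) (fun b => ?_) h1
  have h2 := abs_smoothInt_sub_le hP hp a b
  have h3 := abs_add_le (smoothInt Om P b - smoothInt Om P a - ⟪superposition hp a, b - a⟫)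
    ⟪superposition hp a, b - a⟫
  rw [sub_add_cancel] at h3
  rw [Real.norm_eq_abs]
  linarith

/-- Quadratic coercivity of the sum of the two functionals. -/
theorem exists_coercivity {betah : ℝ → ℝ≥0∞} (hb : LowerSemicontinuous betah)
    (hP : ∀ s, HasDerivAt P (p s) s) (hp : LipschitzWith L p)
    (hco : ∃ α : ℝ, 0 < α ∧ ∀ᶠ s : ℝ in Filter.comap (|·|) atTop,
      ENNReal.ofReal (α * s ^ 2 - P s) ≤ betah s) :
    ∃ α C : ℝ, 0 < α ∧ ∀ v : Hs Om, convexInt Om betah v < ⊤ →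
      α * ‖v‖ ^ 2 - C ≤ (convexInt Om betah v).toReal + smoothInt Om P v := by
  obtain ⟨α, hα, hev⟩ := hco
  have hc : Continuous P := continuous_iff_continuousAt.2 fun s => (hP s).continuousAt
  obtain ⟨t, ht, hsub⟩ := hev
  obtain ⟨R, hR⟩ := mem_atTop_sets.1 ht
  obtain ⟨K, hK⟩ := (isCompact_Icc (a := -R) (b := R)).bddBelow_image hc.continuousOn
  have hpt : ∀ s, ENNReal.ofReal (α * s ^ 2 - P s - (α * R ^ 2 + |K|)) ≤ betah s := by
    intro s
    rcases le_or_gt R |s| with h | h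
    · refine (ENNReal.ofReal_le_ofReal ?_).trans (hsub (hR |s| h))
      have : 0 ≤ α * R ^ 2 + |K| := by positivity
      linarith
    · have h1 : K ≤ P s := hK ⟨s, abs_le.1 h.le, rfl⟩
      have h2 : s ^ 2 ≤ R ^ 2 := by rw [← sq_abs]; exact pow_le_pow_left₀ (abs_nonneg _) h.le 2
      have h3 := mul_le_mul_of_nonneg_left h2 hα.le
      rw [ENNReal.ofReal_of_nonpos (by linarith [neg_abs_le K])]
      exact zero_le
  set M := α * R ^ 2 + |K| with hM
  refine ⟨α, M * (mOm Om).real univ, hα, fun v hv => ?_⟩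
  have hmeas : AEMeasurable (fun x => betah (v x)) (mOm Om) :=
    hb.measurable.comp_aemeasurable (Lp.aestronglyMeasurable v).aemeasurable
  have hfin : ∀ᵐ x ∂(mOm Om), betah (v x) < ⊤ := ae_lt_top' hmeas hv.ne
  have hint : Integrable (fun x => (betah (v x)).toReal) (mOm Om) :=
    integrable_toReal_of_lintegral_ne_top hmeas hv.ne
  have hPv := integrable_smooth_comp hP hp v
  rw [convexInt, ← integral_toReal hmeas hfin, smoothInt, ← integral_add hint hPv,
    ← integral_sq_coeFn, ← integral_const_mul]
  have hcst : M * (mOm Om).real univ = ∫ _, M ∂(mOm Om) := by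
    rw [integral_const, smul_eq_mul, mul_comm]
  rw [hcst, ← integral_sub ((integrable_sq_coeFn v).const_mul _) (integrable_const _)]
  refine integral_mono_ae (((integrable_sq_coeFn v).const_mul _).sub (integrable_const _))
    (hint.add hPv) ?_
  filter_upwards [hfin] with x hx
  have := (ENNReal.ofReal_le_iff_le_toReal hx.ne).1 (hpt (v x))
  linarith

end Functionals

/-! ### The evolution in integrated form -/

section Evolution

variable {Om : Set E3} [IsFiniteMeasure (mOm Om)]

/-- A solution of the system in integrated form: the time derivatives of `y` and the
multiples of it are replaced by increments of `y` and by primitives of `A^r μ` and `z`. -/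
structure Evolution (lamA lamB : ℕ → ℝ) (eA eB : ℕ → Hs Om) (r σ : ℝ) (betah : ℝ → ℝ≥0∞)
    {p : ℝ → ℝ} {L : ℝ≥0} (hp : LipschitzWith L p) (u y μ z : ℝ → Hs Om) (κ : ℝ) : Prop where
  completeA : IsCompleteSystem eA
  completeB : IsCompleteSystem eB
  tendstoB : Tendsto lamB atTop atTop
  pos_σ : 0 < σ
  pos_κ : 0 < κ
  aesm_y : AEStronglyMeasurable y (volume.restrict (Ioi 0))
  bdd : ∀ T, 0 < T → ∃ C, ∀ᵐ t ∂(volume.restrict (Ioc 0 T)),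
    inDom lamB eB σ (y t) ∧ gnormSq lamB eB σ (y t) ≤ C
  inDom_μ : ∀ᵐ t ∂(volume.restrict (Ioi (0:ℝ))), inDom lamA eA r (μ t)
  memLp_flux : ∀ T, 0 < T →
    MemLp (fun t => fracPow lamA eA r (μ t)) 2 (volume.restrict (Ioc 0 T))
  memLp_z : ∀ T, 0 < T → MemLp z 2 (volume.restrict (Ioc 0 T))
  increment : ∀ s t, 0 ≤ s → s ≤ t → ∀ v, inDom lamA eA r v →
    ⟪y t - y s, v⟫ = -⟪∫ x in s..t, fracPow lamA eA r (μ x), fracPow lamA eA r v⟫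
  viscous : ∀ᵐ t ∂(volume.restrict (Ioi (0:ℝ))), ∀ s, 0 ≤ s → s ≤ t →
    ⟪z t, y t - y s⟫ = κ * ⟪z t, ∫ x in s..t, z x⟫
  convexInt_lt_top : ∀ᵐ t ∂(volume.restrict (Ioi (0:ℝ))), convexInt Om betah (y t) < ⊤
  lintegral_convexInt_lt_top : ∀ T, 0 < T →
    ∫⁻ t in Ioc 0 T, convexInt Om betah (y t) < ⊤
  variational : ∀ᵐ t ∂(volume.restrict (Ioi (0:ℝ))), ∀ v,
    inDom lamB eB σ v → convexInt Om betah v < ⊤ →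
    ⟪z t, y t - v⟫ + ⟪fracPow lamB eB σ (y t), fracPow lamB eB σ (y t) - fracPow lamB eB σ v⟫
      + (convexInt Om betah (y t)).toReal + ⟪superposition hp (y t) - u t, y t - v⟫
      ≤ ⟪μ t, y t - v⟫ + (convexInt Om betah v).toReal

theorem ae_restrict_Ioi_of_forall_Ioc {Q : ℝ → Prop}
    (h : ∀ T : ℝ, 0 < T → ∀ᵐ t ∂(volume.restrict (Ioc (0:ℝ) T)), Q t) :
    ∀ᵐ t ∂(volume.restrict (Ioi (0:ℝ))), Q t := by
  have h1 : ∀ n : ℕ, ∀ᵐ t ∂(volume : Measure ℝ), t ∈ Ioc (0:ℝ) (n + 1) → Q t := fun n =>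
    (ae_restrict_iff' measurableSet_Ioc).1 (h (n + 1) (by positivity))
  rw [ae_restrict_iff' measurableSet_Ioi]
  filter_upwards [ae_all_iff.2 h1] with t ht ht0
  obtain ⟨n, hn⟩ := exists_nat_ge t
  exact ht n ⟨ht0, hn.trans (by simp)⟩

theorem intervalIntegrable_of_Ioc {F : Type*} [NormedAddCommGroup F] {f : ℝ → F}
    (h : ∀ T : ℝ, 0 < T → IntegrableOn f (Ioc 0 T)) {s t : ℝ} (hs : 0 ≤ s) (hst : s ≤ t) :
    IntervalIntegrable f volume s t := by
  rw [intervalIntegrable_iff_integrableOn_Ioc_of_le hst]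
  rcases hst.eq_or_lt with rfl | h1
  · simp
  · exact (h t (hs.trans_lt h1)).mono_set (Ioc_subset_Ioc_left hs)

theorem integrableOn_of_memLp_two {F : Type*} [NormedAddCommGroup F] {f : ℝ → F}
    (h : ∀ T : ℝ, 0 < T → MemLp f 2 (volume.restrict (Ioc 0 T))) (T : ℝ) (hT : 0 < T) :
    IntegrableOn f (Ioc 0 T) := (h T hT).integrable (by norm_num)

theorem integrableOn_sq_of_memLp_two {F : Type*} [NormedAddCommGroup F] {f : ℝ → F}
    (h : ∀ T : ℝ, 0 < T → MemLp f 2 (volume.restrict (Ioc 0 T))) (T : ℝ) (hT : 0 < T) :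
    IntegrableOn (fun t => ‖f t‖ ^ 2) (Ioc 0 T) := (h T hT).integrable_norm_pow (by norm_num)

theorem inner_intervalIntegral {X : Type*} [NormedAddCommGroup X] [InnerProductSpace ℝ X]
    [CompleteSpace X] {f : ℝ → X} {s t : ℝ} (hst : s ≤ t) (hf : IntervalIntegrable f volume s t)
    (v : X) : ⟪∫ x in s..t, f x, v⟫ = ∫ x in s..t, ⟪f x, v⟫ := by
  rw [intervalIntegral.integral_of_le hst, intervalIntegral.integral_of_le hst, real_inner_comm,
    ← integral_inner ((intervalIntegrable_iff_integrableOn_Ioc_of_le hst).1 hf)]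
  simp only [real_inner_comm v]

theorem aemeasurable_comp_of_lowerSemicontinuous {X : Type*} [TopologicalSpace X]
    [TopologicalSpace.PseudoMetrizableSpace X] {F : X → ℝ≥0∞} (hF : LowerSemicontinuous F)
    {ν : Measure ℝ} {f : ℝ → X} (hf : AEStronglyMeasurable f ν) :
    AEMeasurable (fun t => F (f t)) ν := by
  borelize X
  exact hF.measurable.comp_aemeasurable hf.aemeasurable

/-- A property that holds a.e. in `(a, T]` holds along a sequence approaching from the left
any given point of this interval. -/
theorem exists_seq_tendsto_of_ae {Q : ℝ → Prop} {a T : ℝ}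
    (h : ∀ᵐ t ∂(volume.restrict (Ioc a T)), Q t) {t : ℝ} (ht : t ∈ Ioc a T) :
    ∃ s : ℕ → ℝ, (∀ n, s n ∈ Ioc a t ∧ Q (s n)) ∧ Tendsto s atTop (𝓝 t) := by
  have hex : ∀ n : ℕ, ∃ s, s ∈ Ioc (max a (t - 1 / (n + 1))) t ∧ Q s := by
    intro n
    have hlt : max a (t - 1 / ((n:ℝ) + 1)) < t :=
      max_lt ht.1 (sub_lt_self _ (by positivity))
    have h1 : ∀ᵐ s ∂(volume.restrict (Ioc (max a (t - 1 / ((n:ℝ) + 1))) t)), Q s :=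
      ae_restrict_of_ae_restrict_of_subset (Ioc_subset_Ioc (le_max_left _ _) ht.2) h
    have h2 := h1.and (ae_restrict_mem measurableSet_Ioc)
    have : (ae (volume.restrict (Ioc (max a (t - 1 / ((n:ℝ) + 1))) t))).NeBot := by
      rw [ae_neBot, Ne, Measure.restrict_eq_zero, Real.volume_Ioc]
      simpa using hlt
    obtain ⟨s, hs⟩ := h2.exists
    exact ⟨s, hs.2, hs.1⟩
  choose s hs hQ using hex
  refine ⟨s, fun n => ⟨⟨(le_max_left _ _).trans_lt (hs n).1, (hs n).2⟩, hQ n⟩, ?_⟩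
  refine tendsto_of_tendsto_of_tendsto_of_le_of_le (g := fun n : ℕ => t - 1 / ((n:ℝ) + 1)) ?_
    tendsto_const_nhds (fun n => ((le_max_right _ _).trans_lt (hs n).1).le) fun n => (hs n).2
  simpa using tendsto_one_div_add_atTop_nhds_zero_nat.const_sub t

namespace IsSolution

variable {lamA lamB : ℕ → ℝ} {eA eB : ℕ → Hs Om} {r σ τ : ℝ} {betah : ℝ → ℝ≥0∞}
  {pih p : ℝ → ℝ} {L : ℝ≥0} {u u' : ℝ → Hs Om} {y0 : Hs Om} {y μ z : ℝ → Hs Om}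
  {dy : ℝ → Hs Om →ₗ[ℝ] ℝ}

theorem evolution (hset : SettingHyps Om lamA lamB eA eB r σ τ)
    (hb : LowerSemicontinuous betah) (hp : LipschitzWith L p)
    (hsol : IsSolution Om lamA lamB eA eB r σ τ betah p u y0 y μ dy z) :
    ∃ κ, Evolution lamA lamB eA eB r σ betah hp u y μ z κ := by
  obtain ⟨-, -, -, -, -, -, -, -, htB, hoA, hoB, hcA, hcB, -, hσ, hτ, -⟩ := hset
  obtain ⟨hym, hyd, hyb, hdyi, hdyint, -, hzm, hz, hz2, hμm, hμd, hμ2, hβ, heq, hvi, -⟩ := hsol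
  have heA : IsCompleteSystem eA := ⟨hoA, hcA⟩
  have heB : IsCompleteSystem eB := ⟨hoB, hcB⟩
  have hsub : ∀ T : ℝ, volume.restrict (Ioc 0 T) ≤ volume.restrict (Ioi (0:ℝ)) := fun T =>
    Measure.restrict_mono Ioc_subset_Ioi_self le_rfl
  have hgm := heA.aestronglyMeasurable_fracPow hμm hμd
  have hg : ∀ T, 0 < T →
      MemLp (fun t => fracPow lamA eA r (μ t)) 2 (volume.restrict (Ioc 0 T)) := by
    intro T hT
    have hm := hgm.mono_measure (hsub T)
    rw [memLp_two_iff_integrable_sq_norm hm]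
    refine (hμ2 T hT).mono' (hm.norm.pow 2) (Eventually.of_forall fun t => ?_)
    rw [Real.norm_of_nonneg (by positivity), gnormSq]
    linarith [sq_nonneg ‖μ t‖]
  have hzL : ∀ T, 0 < T → MemLp z 2 (volume.restrict (Ioc 0 T)) := fun T hT =>
    (memLp_two_iff_integrable_sq_norm (hzm.mono_measure (hsub T))).2 (hz2 T hT)
  have hdyi' : ∀ v, inDom lamA eA r v → ∀ s t : ℝ, 0 ≤ s → s ≤ t →
      ⟪y t - y s, v⟫ = ∫ x in s..t, dy x v := by
    intro v hv s t hs hst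
    rw [inner_sub_left, hdyint v hv t (hs.trans hst), hdyint v hv s hs,
      add_sub_add_left_eq_sub]
    exact intervalIntegral.integral_interval_sub_left
      (intervalIntegrable_of_Ioc (hdyi v hv) le_rfl (hs.trans hst))
      (intervalIntegrable_of_Ioc (hdyi v hv) le_rfl hs)
  have hIoi : ∀ {s t : ℝ}, 0 ≤ s → s ≤ t → ∀ {Q : ℝ → Prop},
      (∀ᵐ x ∂(volume.restrict (Ioi (0:ℝ))), Q x) → ∀ᵐ x, x ∈ uIoc s t → Q x := by
    intro s t hs hst Q hQ
    filter_upwards [(ae_restrict_iff' measurableSet_Ioi).1 hQ] with x hx hxt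
    rw [uIoc_of_le hst] at hxt
    exact hx (hs.trans_lt hxt.1)
  have hzrel : ∀ s t : ℝ, 0 ≤ s → s ≤ t → ∫ x in s..t, z x = τ • (y t - y s) := by
    intro s t hs hst
    have hi := intervalIntegrable_of_Ioc (integrableOn_of_memLp_two hzL) hs hst
    refine (heA.dense_inDom (lam := lamA) (ρ := r)).eq_of_inner_left (𝕜 := ℝ) fun v hv => ?_
    rw [inner_intervalIntegral hst hi, real_inner_smul_left, hdyi' v hv s t hs hst,
      ← intervalIntegral.integral_const_mul]
    exact intervalIntegral.integral_congr_ae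
      ((hIoi hs hst hz).mono fun x hx hxt => hx hxt v hv)
  obtain ⟨κ, hκ, hvisc⟩ : ∃ κ, 0 < κ ∧ ∀ᵐ t ∂(volume.restrict (Ioi (0:ℝ))), ∀ s, 0 ≤ s → s ≤ t →
      ⟪z t, y t - y s⟫ = κ * ⟪z t, ∫ x in s..t, z x⟫ := by
    rcases hτ.1.eq_or_lt with rfl | hτ0
    · refine ⟨1, one_pos, ?_⟩
      filter_upwards [hz] with t ht s _ _
      have : z t = 0 := by
        refine (heA.dense_inDom (lam := lamA) (ρ := r)).eq_zero_of_inner_left (𝕜 := ℝ)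
          fun v hv => ?_
        simpa using ht v hv
      simp [this]
    · refine ⟨τ⁻¹, inv_pos.2 hτ0, Eventually.of_forall fun t s hs hst => ?_⟩
      rw [hzrel s t hs hst, real_inner_smul_right, inv_mul_cancel_left₀ hτ0.ne']
  refine ⟨κ, heA, heB, htB, hσ, hκ, hym, fun T hT => ?_, hμd, hg, hzL, ?_, hvisc, ?_, hβ, ?_⟩
  · obtain ⟨C, hC⟩ := hyb T hT
    exact ⟨C, (Eventually.filter_mono (ae_mono (hsub T)) hyd).and hC⟩
  · intro s t hs hst v hv
    rw [hdyi' v hv s t hs hst, inner_intervalIntegral hst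
      (intervalIntegrable_of_Ioc (integrableOn_of_memLp_two hg) hs hst),
      ← intervalIntegral.integral_neg]
    exact intervalIntegral.integral_congr_ae ((hIoi hs hst heq).mono
      fun x hx hxt => eq_neg_of_add_eq_zero_left (hx hxt v hv))
  · refine ae_restrict_Ioi_of_forall_Ioc fun T hT => ?_
    exact ae_lt_top' (aemeasurable_comp_of_lowerSemicontinuous
      (lowerSemicontinuous_convexInt hb) (hym.mono_measure (hsub T))) (hβ T hT).ne
  · filter_upwards [hvi] with t ht v hv hv'
    rw [← integral_superposition_sub]
    exact ht v hv hv'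

end IsSolution

end Evolution

/-! ### Pointwise bounds and the energy inequality -/

namespace Evolution

variable {Om : Set E3} [IsFiniteMeasure (mOm Om)]
  {lamA lamB : ℕ → ℝ} {eA eB : ℕ → Hs Om} {r σ : ℝ} {betah : ℝ → ℝ≥0∞}
  {P p : ℝ → ℝ} {L : ℝ≥0} {hp : LipschitzWith L p} {u u' y μ z : ℝ → Hs Om} {κ : ℝ}

theorem norm_integral_flux_sq_le (h : Evolution lamA lamB eA eB r σ betah hp u y μ z κ)
    {s t : ℝ} (hs : 0 ≤ s) (hst : s ≤ t) :
    ‖∫ x in s..t, fracPow lamA eA r (μ x)‖ ^ 2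
      ≤ (t - s) * ∫ x in s..t, ‖fracPow lamA eA r (μ x)‖ ^ 2 :=
  norm_integral_sq_le hst
    (intervalIntegrable_of_Ioc (integrableOn_of_memLp_two h.memLp_flux) hs hst)
    (intervalIntegrable_of_Ioc (integrableOn_sq_of_memLp_two h.memLp_flux) hs hst)

/-- Bounds valid at almost all times are valid at all times. -/
theorem bounds_of_ae_bounds (h : Evolution lamA lamB eA eB r σ betah hp u y μ z κ)
    {a T C D : ℝ} (ha : 0 ≤ a) (hae : ∀ᵐ t ∂(volume.restrict (Ioc a T)),
      inDom lamB eB σ (y t) ∧ ‖y t‖ ≤ C ∧ ‖fracPow lamB eB σ (y t)‖ ≤ D) :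
    ∀ t ∈ Ioc a T, inDom lamB eB σ (y t) ∧ ‖y t‖ ≤ C ∧ ‖fracPow lamB eB σ (y t)‖ ≤ D := by
  intro t ht
  obtain ⟨s, hs, hlim⟩ := exists_seq_tendsto_of_ae hae ht
  have hs0 : ∀ n, 0 ≤ s n := fun n => ha.trans (hs n).1.1.le
  have hst : ∀ n, s n ≤ t := fun n => (hs n).1.2
  have hC : 0 ≤ C := (norm_nonneg _).trans (hs 0).2.2.1
  have hD : 0 ≤ D := (norm_nonneg _).trans (hs 0).2.2.2
  have hflux : Tendsto (fun n => ∫ x in s n..t, fracPow lamA eA r (μ x)) atTop (𝓝 0) := by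
    rw [tendsto_zero_iff_norm_tendsto_zero]
    have h1 : Tendsto (fun n => (t - s n) * ∫ x in (0:ℝ)..t, ‖fracPow lamA eA r (μ x)‖ ^ 2)
        atTop (𝓝 0) := by
      simpa using (hlim.const_sub t).mul_const (∫ x in (0:ℝ)..t, ‖fracPow lamA eA r (μ x)‖ ^ 2)
    have h2 : Tendsto (fun n => ‖∫ x in s n..t, fracPow lamA eA r (μ x)‖ ^ 2) atTop (𝓝 0) := by
      refine squeeze_zero (fun _ => by positivity) (fun n => ?_) h1
      refine (h.norm_integral_flux_sq_le (hs0 n) (hst n)).trans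
        (mul_le_mul_of_nonneg_left ?_ (sub_nonneg.2 (hst n)))
      exact intervalIntegral.integral_mono_interval (hs0 n) (hst n) le_rfl
        (Eventually.of_forall fun x => by positivity)
        (intervalIntegrable_of_Ioc (integrableOn_sq_of_memLp_two h.memLp_flux) le_rfl
          ((hs0 n).trans (hst n)))
    simpa [Function.comp_def, Real.sqrt_sq] using (Real.continuous_sqrt.tendsto 0).comp h2
  have hA : ∀ j, Tendsto (fun n => ⟪y (s n), eA j⟫) atTop (𝓝 ⟪y t, eA j⟫) := fun j => by
    have h1 : ∀ n, ⟪y (s n), eA j⟫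
        = ⟪y t, eA j⟫ + ⟪∫ x in s n..t, fracPow lamA eA r (μ x), fracPow lamA eA r (eA j)⟫ :=
      fun n => by
        have := h.increment (s n) t (hs0 n) (hst n) (eA j) (h.completeA.inDom_basis j)
        rw [inner_sub_left] at this
        linarith
    simp only [h1]
    simpa using (hflux.inner (tendsto_const_nhds (x := fracPow lamA eA r (eA j)))).const_add
      ⟪y t, eA j⟫
  have hyt : ‖y t‖ ≤ C := by
    have h1 := specEnergy_le_of_tendsto (lam := lamA) (ρ := 0) hA (C := ENNReal.ofReal (C ^ 2))
      (Eventually.of_forall fun n => by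
        rw [h.completeA.specEnergy_zero]
        exact ENNReal.ofReal_le_ofReal (pow_le_pow_left₀ (norm_nonneg _) (hs n).2.2.1 2))
    rw [h.completeA.specEnergy_zero, ENNReal.ofReal_le_ofReal_iff (by positivity)] at h1
    exact le_of_sq_le_sq h1 hC
  have hB : ∀ j, Tendsto (fun n => ⟪y (s n), eB j⟫) atTop (𝓝 ⟪y t, eB j⟫) := fun j => by
    rw [Metric.tendsto_atTop]
    intro ε hε
    obtain ⟨K, hK, hle⟩ := h.completeA.abs_inner_le (lam := lamA) (ρ := r) (eB j)
      (η := ε / (4 * (C + 1))) (by positivity)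
    have h1 : Tendsto (fun n => K * ‖∫ x in s n..t, fracPow lamA eA r (μ x)‖) atTop (𝓝 0) := by
      simpa using hflux.norm.const_mul K
    obtain ⟨N, hN⟩ := eventually_atTop.1 (h1.eventually (gt_mem_nhds (half_pos hε)))
    refine ⟨N, fun n hn => ?_⟩
    have h2 := hle (y t - y (s n)) _ (h.increment (s n) t (hs0 n) (hst n))
    have h3 : ‖y t - y (s n)‖ ≤ 2 * (C + 1) := by
      linarith [norm_sub_le (y t) (y (s n)), (hs n).2.2.1]
    have h4 : ε / (4 * (C + 1)) * ‖y t - y (s n)‖ ≤ ε / 2 := by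
      refine (mul_le_mul_of_nonneg_left h3 (by positivity)).trans (le_of_eq ?_)
      field_simp
      norm_num
    rw [dist_comm, Real.dist_eq, ← inner_sub_left]
    linarith [hN n hn]
  have h1 := specEnergy_le_of_tendsto (lam := lamB) (ρ := σ) hB (C := ENNReal.ofReal (D ^ 2))
    (Eventually.of_forall fun n => by
      rw [h.completeB.specEnergy_eq (hs n).2.1]
      exact ENNReal.ofReal_le_ofReal (pow_le_pow_left₀ (norm_nonneg _) (hs n).2.2.2 2))
  have hdom : inDom lamB eB σ (y t) :=
    inDom_iff_specEnergy_ne_top.2 (h1.trans_lt ENNReal.ofReal_lt_top).ne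
  rw [h.completeB.specEnergy_eq hdom, ENNReal.ofReal_le_ofReal_iff (by positivity)] at h1
  exact ⟨hdom, hyt, le_of_sq_le_sq h1 hD⟩

theorem exists_bounds (h : Evolution lamA lamB eA eB r σ betah hp u y μ z κ)
    {T : ℝ} (hT : 0 < T) :
    ∃ M, 0 ≤ M ∧ ∀ t ∈ Ioc 0 T,
      inDom lamB eB σ (y t) ∧ ‖y t‖ ≤ M ∧ ‖fracPow lamB eB σ (y t)‖ ≤ M := by
  obtain ⟨C, hC⟩ := h.bdd T hT
  refine ⟨√C, Real.sqrt_nonneg _, h.bounds_of_ae_bounds le_rfl (hC.mono fun t ht => ?_)⟩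
  have h2 := ht.2
  rw [gnormSq] at h2
  exact ⟨ht.1, Real.le_sqrt_of_sq_le (by linarith [sq_nonneg ‖fracPow lamB eB σ (y t)‖]),
    Real.le_sqrt_of_sq_le (by linarith [sq_nonneg ‖y t‖])⟩

/-- The energy of the state `v` in the presence of the forcing term `f`. -/
def _root_.FracCH.energy (lamB : ℕ → ℝ) (eB : ℕ → Hs Om) (σ : ℝ) (betah : ℝ → ℝ≥0∞) (P : ℝ → ℝ)
    (f v : Hs Om) : ℝ :=
  1 / 2 * ‖fracPow lamB eB σ v‖ ^ 2 + (convexInt Om betah v).toReal + smoothInt Om P v - ⟪f, v⟫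

theorem energy_increment (h : Evolution lamA lamB eA eB r σ betah hp u y μ z κ)
    (hP : ∀ s, HasDerivAt P (p s) s) :
    ∃ C : ℝ, 0 ≤ C ∧ ∃ S : Set ℝ, (∀ᵐ t, t ∈ S) ∧ ∀ s ∈ S, ∀ t ∈ S, 0 < s → s < t →
      energy lamB eB σ betah P (u t) (y t) - energy lamB eB σ betah P (u s) (y s)
        ≤ -⟪fracPow lamA eA r (μ t), ∫ x in s..t, fracPow lamA eA r (μ x)⟫
          - κ * ⟪z t, ∫ x in s..t, z x⟫
          + C * ‖∫ x in s..t, fracPow lamA eA r (μ x)‖ ^ 2 + ‖u t - u s‖ * ‖y s‖ := by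
  have hε : 0 < 1 / (4 * ((L:ℝ) + 1)) := by positivity
  obtain ⟨C, hC, hehr⟩ :=
    ehrling h.completeA h.completeB h.tendstoB h.pos_σ hε (lamA := lamA) (r := r)
  have hgood := (h.inDom_μ.and (h.viscous.and (h.convexInt_lt_top.and h.variational)))
  rw [ae_restrict_iff' measurableSet_Ioi] at hgood
  refine ⟨2 * L * C, by positivity, _, hgood, ?_⟩
  intro s hs t ht hs0 hst
  obtain ⟨-, -, hcs, -⟩ := hs hs0
  obtain ⟨hμt, hvt, -, hvar⟩ := ht (hs0.trans hst)
  obtain ⟨M, -, hM⟩ := h.exists_bounds (hs0.trans hst)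
  have hys := (hM s ⟨hs0, hst.le⟩).1
  have hyt := (hM t ⟨hs0.trans hst, le_rfl⟩).1
  have hinc := h.increment s t hs0.le hst.le
  have h1 := hvar (y s) hys hcs
  have h2 := hvt s hs0.le hst.le
  have h3 := hinc (μ t) hμt
  have h4 := hehr (y t - y s) _ (inDom_sub hyt hys) hinc
  have h5 := abs_smoothInt_sub_le hP hp (y t) (y s)
  have h6 := (abs_le.1 h5).1
  rw [← neg_sub (y t) (y s), inner_neg_right, norm_neg] at h6
  rw [h.completeB.fracPow_sub hyt hys] at h4
  have h7 : ⟪fracPow lamB eB σ (y t), fracPow lamB eB σ (y t) - fracPow lamB eB σ (y s)⟫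
      = 1 / 2 * ‖fracPow lamB eB σ (y t)‖ ^ 2 - 1 / 2 * ‖fracPow lamB eB σ (y s)‖ ^ 2
        + 1 / 2 * ‖fracPow lamB eB σ (y t) - fracPow lamB eB σ (y s)‖ ^ 2 := by
    rw [norm_sub_sq_real, inner_sub_right, real_inner_self_eq_norm_sq]
    ring
  have h8 : ⟪u t, y t⟫ - ⟪u s, y s⟫ = ⟪u t, y t - y s⟫ + ⟪u t - u s, y s⟫ := by
    rw [inner_sub_right, inner_sub_left]
    ring
  have h9 := (abs_le.1 (abs_real_inner_le_norm (u t - u s) (y s))).1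
  rw [real_inner_comm] at h3
  rw [real_inner_comm (∫ x in s..t, fracPow lamA eA r (μ x))]
  have h10 : (L:ℝ) * ‖y t - y s‖ ^ 2
      ≤ 1 / 2 * ‖fracPow lamB eB σ (y t) - fracPow lamB eB σ (y s)‖ ^ 2
        + 2 * L * C * ‖∫ x in s..t, fracPow lamA eA r (μ x)‖ ^ 2 := by
    set d := ‖y t - y s‖ ^ 2 with hd
    set b := ‖fracPow lamB eB σ (y t) - fracPow lamB eB σ (y s)‖ ^ 2 with hb
    set q := ‖∫ x in s..t, fracPow lamA eA r (μ x)‖ ^ 2 with hq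
    have hL : (0:ℝ) ≤ L := L.2
    have hb0 : 0 ≤ b := by positivity
    have hq0 : 0 ≤ L * (C * q) := by positivity
    have h11 : 4 * ((L:ℝ) + 1) * d ≤ d + b + 4 * (L + 1) * (C * q) := by
      have := mul_le_mul_of_nonneg_left h4 (by positivity : 0 ≤ 4 * ((L:ℝ) + 1))
      refine this.trans (le_of_eq ?_)
      field_simp
    have h12 := mul_le_mul_of_nonneg_left h11 hL
    have h13 := mul_nonneg hL hb0
    have h14 := mul_nonneg hL hq0
    refine le_of_mul_le_mul_left ?_ (by positivity : 0 < 4 * (L:ℝ) + 3)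
    nlinarith
  rw [inner_sub_left (superposition hp (y t))] at h1
  rw [energy, energy]
  linarith

end Evolution

/-! ### The forcing term -/

section Forcing

variable {X : Type*} [NormedAddCommGroup X] [NormedSpace ℝ X] {u u' : ℝ → X}

/-- `u` is a primitive on `[0, ∞)` of the integrable function `u'`. -/
def IsPrimitive (u u' : ℝ → X) : Prop :=
  IntegrableOn u' (Ioi 0) ∧ ∀ t : ℝ, 0 ≤ t → u t = u 0 + ∫ s in (0:ℝ)..t, u' s

namespace IsPrimitive

theorem intervalIntegrable (hu : IsPrimitive u u') {s t : ℝ} (hs : 0 ≤ s) (hst : s ≤ t) :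
    IntervalIntegrable u' volume s t :=
  intervalIntegrable_of_Ioc (fun _ _ => hu.1.mono_set Ioc_subset_Ioi_self) hs hst

theorem sub_eq (hu : IsPrimitive u u') {s t : ℝ} (hs : 0 ≤ s) (hst : s ≤ t) :
    u t - u s = ∫ x in s..t, u' x := by
  rw [hu.2 t (hs.trans hst), hu.2 s hs, add_sub_add_left_eq_sub]
  exact intervalIntegral.integral_interval_sub_left
    (hu.intervalIntegrable le_rfl (hs.trans hst)) (hu.intervalIntegrable le_rfl hs)

theorem norm_sub_le (hu : IsPrimitive u u') {s t : ℝ} (hs : 0 ≤ s) (hst : s ≤ t) :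
    ‖u t - u s‖ ≤ ∫ x in s..t, ‖u' x‖ := by
  rw [hu.sub_eq hs hst]
  exact intervalIntegral.norm_integral_le_integral_norm hst

theorem integral_norm_le (hu : IsPrimitive u u') {s t : ℝ} (hs : 0 ≤ s) (hst : s ≤ t) :
    ∫ x in s..t, ‖u' x‖ ≤ ∫ x in Ioi 0, ‖u' x‖ := by
  rw [intervalIntegral.integral_of_le hst]
  exact setIntegral_mono_set hu.1.norm (Eventually.of_forall fun _ => norm_nonneg _)
    (LE.le.eventuallyLE (Ioc_subset_Ioi_self.trans (Ioi_subset_Ioi hs)))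

theorem norm_le (hu : IsPrimitive u u') {t : ℝ} (ht : 0 ≤ t) :
    ‖u t‖ ≤ ‖u 0‖ + ∫ x in Ioi 0, ‖u' x‖ := by
  have h1 := (hu.norm_sub_le le_rfl ht).trans (hu.integral_norm_le le_rfl ht)
  have h2 := norm_add_le (u 0) (u t - u 0)
  rw [add_sub_cancel] at h2
  linarith

theorem continuousOn (hu : IsPrimitive u u') : ContinuousOn u (Ici 0) := by
  have h1 : Continuous fun t => u 0 + ∫ s in (0:ℝ)..t, (Ioi 0).indicator u' s :=
    continuous_const.add ((hu.1.integrable_indicator measurableSet_Ioi).continuous_primitive 0)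
  refine h1.continuousOn.congr fun t ht => ?_
  rw [hu.2 t ht]
  congr 1
  refine intervalIntegral.integral_congr_ae (Eventually.of_forall fun x hx => ?_)
  rw [uIoc_of_le ht] at hx
  exact (indicator_of_mem (mem_Ioi.2 hx.1) _).symm

/-- A primitive of an integrable function whose distance to `a` is square integrable
converges to `a`. -/
theorem tendsto (hu : IsPrimitive u u') {a : X}
    (ha : IntegrableOn (fun t => ‖u t - a‖ ^ 2) (Ioi 0)) : Tendsto u atTop (𝓝 a) := by
  have h1 : Tendsto (fun t : ℝ => u 0 + ∫ s in (0:ℝ)..t, u' s) atTop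
      (𝓝 (u 0 + ∫ s in Ioi 0, u' s)) :=
    (intervalIntegral_tendsto_integral_Ioi 0 hu.1 tendsto_id).const_add (u 0)
  have h2 : Tendsto u atTop (𝓝 (u 0 + ∫ s in Ioi 0, u' s)) :=
    h1.congr' ((eventually_ge_atTop 0).mono fun t ht => (hu.2 t ht).symm)
  set b := u 0 + ∫ s in Ioi 0, u' s
  by_contra hne
  have hba : 0 < ‖b - a‖ ^ 2 := by
    refine pow_pos (norm_pos_iff.2 (sub_ne_zero.2 ?_)) 2
    rintro rfl
    exact hne h2
  have h3 : Tendsto (fun t => ‖u t - a‖ ^ 2) atTop (𝓝 (‖b - a‖ ^ 2)) :=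
    ((h2.sub_const a).norm).pow 2
  obtain ⟨R, hR⟩ := eventually_atTop.1 (h3.eventually (lt_mem_nhds (half_lt_self hba)))
  have h4 : IntegrableOn (fun _ : ℝ => ‖b - a‖ ^ 2 / 2) (Ioi (max R 0)) := by
    refine (ha.mono_set (Ioi_subset_Ioi (le_max_right _ _))).mono' aestronglyMeasurable_const ?_
    filter_upwards [ae_restrict_mem measurableSet_Ioi] with t ht
    rw [Real.norm_of_nonneg (by positivity)]
    exact (hR t ((le_max_left _ _).trans ht.le)).le
  rw [integrableOn_const_iff] at h4
  simp [hba.ne'] at h4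

end IsPrimitive

theorem intervalIntegral_indicator_Ioc {f : ℝ → X} {s t T : ℝ} (hs : 0 ≤ s) (hst : s ≤ t)
    (ht : t ≤ T) : ∫ x in s..t, (Ioc 0 T).indicator f x = ∫ x in s..t, f x := by
  refine intervalIntegral.integral_congr_ae (Eventually.of_forall fun x hx => ?_)
  rw [uIoc_of_le hst] at hx
  exact indicator_of_mem (s := Ioc 0 T) ⟨hs.trans_lt hx.1, hx.2.trans ht⟩ _

end Forcing

theorem locallyIntegrable_indicator_Ioc {F : Type*} [NormedAddCommGroup F] {f : ℝ → F} {T : ℝ}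
    (hf : IntegrableOn f (Ioc 0 T)) :
    LocallyIntegrable ((Ioc 0 T).indicator f) :=
  (hf.integrable_indicator measurableSet_Ioc).locallyIntegrable

theorem norm_sq_indicator {F : Type*} [NormedAddCommGroup F] (f : ℝ → F) (A : Set ℝ) :
    (fun t => ‖A.indicator f t‖ ^ 2) = A.indicator fun t => ‖f t‖ ^ 2 := by
  ext t
  by_cases ht : t ∈ A <;> simp [ht]

namespace Evolution

variable {Om : Set E3} [IsFiniteMeasure (mOm Om)]
  {lamA lamB : ℕ → ℝ} {eA eB : ℕ → Hs Om} {r σ : ℝ} {betah : ℝ → ℝ≥0∞}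
  {P p : ℝ → ℝ} {L : ℝ≥0} {hp : LipschitzWith L p} {u u' y μ z : ℝ → Hs Om} {κ : ℝ}

theorem integrableOn_energy (h : Evolution lamA lamB eA eB r σ betah hp u y μ z κ)
    (hb : LowerSemicontinuous betah) (hP : ∀ s, HasDerivAt P (p s) s) (hu : IsPrimitive u u')
    {T : ℝ} (hT : 0 < T) :
    IntegrableOn (fun t => energy lamB eB σ betah P (u t) (y t)) (Ioc 0 T) := by
  obtain ⟨M, hM, hbd⟩ := h.exists_bounds hT
  have hmem : ∀ᵐ t ∂(volume.restrict (Ioc 0 T)), t ∈ Ioc 0 T := ae_restrict_mem measurableSet_Ioc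
  have hy : AEStronglyMeasurable y (volume.restrict (Ioc 0 T)) :=
    h.aesm_y.mono_measure (Measure.restrict_mono Ioc_subset_Ioi_self le_rfl)
  have hyd : ∀ᵐ t ∂(volume.restrict (Ioc 0 T)), inDom lamB eB σ (y t) :=
    hmem.mono fun t ht => (hbd t ht).1
  have hBy := h.completeB.aestronglyMeasurable_fracPow hy hyd
  have hum : AEStronglyMeasurable u (volume.restrict (Ioc 0 T)) :=
    (hu.continuousOn.mono fun t ht => ht.1.le).aestronglyMeasurable measurableSet_Ioc
  have hsm := continuous_smoothInt hP hp (Om := Om)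
  have h1 : IntegrableOn (fun t => 1 / 2 * ‖fracPow lamB eB σ (y t)‖ ^ 2) (Ioc 0 T) := by
    refine Integrable.of_bound ((hBy.norm.pow 2).const_mul _) (1 / 2 * M ^ 2)
      (hmem.mono fun t ht => ?_)
    rw [Real.norm_of_nonneg (by positivity)]
    gcongr
    exact (hbd t ht).2.2
  have h2 : IntegrableOn (fun t => (convexInt Om betah (y t)).toReal) (Ioc 0 T) :=
    integrable_toReal_of_lintegral_ne_top
      (aemeasurable_comp_of_lowerSemicontinuous (lowerSemicontinuous_convexInt hb) hy)
      (h.lintegral_convexInt_lt_top T hT).ne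
  have h3 : IntegrableOn (fun t => smoothInt Om P (y t)) (Ioc 0 T) := by
    refine Integrable.of_bound (hsm.comp_aestronglyMeasurable hy)
      (|smoothInt Om P (0 : Hs Om)| + ‖superposition hp (0 : Hs Om)‖ * M + L * M ^ 2)
      (hmem.mono fun t ht => ?_)
    have h4 := abs_smoothInt_sub_le hP hp 0 (y t)
    rw [sub_zero] at h4
    have h5 := (abs_real_inner_le_norm (superposition hp 0) (y t)).trans
      (mul_le_mul_of_nonneg_left (hbd t ht).2.1 (norm_nonneg _))
    have h6 : L * ‖y t‖ ^ 2 ≤ L * M ^ 2 := by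
      gcongr
      exact (hbd t ht).2.1
    rw [Real.norm_eq_abs, abs_le]
    rw [abs_le] at h4 h5
    constructor <;> linarith [neg_abs_le (smoothInt Om P (0 : Hs Om)),
      le_abs_self (smoothInt Om P (0 : Hs Om))]
  have h4 : IntegrableOn (fun t => ⟪u t, y t⟫) (Ioc 0 T) := by
    refine Integrable.of_bound (hum.inner hy) ((‖u 0‖ + ∫ x in Ioi 0, ‖u' x‖) * M)
      (hmem.mono fun t ht => ?_)
    exact (norm_inner_le_norm _ _).trans (mul_le_mul (hu.norm_le ht.1.le) (hbd t ht).2.1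
      (norm_nonneg _) ((norm_nonneg _).trans (hu.norm_le ht.1.le)))
  exact ((h1.add h2).add h3).sub h4

theorem energy_inequality (h : Evolution lamA lamB eA eB r σ betah hp u y μ z κ)
    (hb : LowerSemicontinuous betah) (hP : ∀ s, HasDerivAt P (p s) s) (hu : IsPrimitive u u')
    {T M : ℝ} (hT : 0 < T) (hM : ∀ t ∈ Ioc 0 T, ‖y t‖ ≤ M) :
    ∀ᵐ a, ∀ᵐ b, 0 < a → a < b → b < T →
      energy lamB eB σ betah P (u b) (y b) + (∫ t in a..b, ‖fracPow lamA eA r (μ t)‖ ^ 2)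
          + κ * (∫ t in a..b, ‖z t‖ ^ 2)
        ≤ energy lamB eB σ betah P (u a) (y a) + M * ∫ t in a..b, ‖u' t‖ := by
  obtain ⟨C, hC, S, hS, hinc⟩ := h.energy_increment hP
  set E : ℝ → ℝ := fun t => energy lamB eB σ betah P (u t) (y t)
  set f : ℝ → Hs Om := fun t => fracPow lamA eA r (μ t)
  set g : ℝ → Hs Om := fun t => √κ • z t
  set ρ : ℝ → ℝ := fun t => M * ‖u' t‖
  have hκ : √κ * √κ = κ := Real.mul_self_sqrt h.pos_κ.le
  have hfi := integrableOn_of_memLp_two h.memLp_flux T hT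
  have hf2 := integrableOn_sq_of_memLp_two h.memLp_flux T hT
  have hgi : IntegrableOn g (Ioc 0 T) := (integrableOn_of_memLp_two h.memLp_z T hT).smul √κ
  have hg2e : ∀ t, ‖g t‖ ^ 2 = κ * ‖z t‖ ^ 2 := fun t => by
    rw [norm_smul, mul_pow, Real.norm_eq_abs, sq_abs, Real.sq_sqrt h.pos_κ.le]
  have hg2 : IntegrableOn (fun t => ‖g t‖ ^ 2) (Ioc 0 T) := by
    simp only [hg2e]
    exact (integrableOn_sq_of_memLp_two h.memLp_z T hT).const_mul κ
  have hρ : IntegrableOn ρ (Ioc 0 T) := (hu.1.mono_set Ioc_subset_Ioi_self).norm.const_mul M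
  have key := energy_inequality_of_increments (E := (Ioc 0 T).indicator E)
    (ρ := (Ioc 0 T).indicator ρ) (f := (Ioc 0 T).indicator f) (g := (Ioc 0 T).indicator g)
    (C := C) (a₀ := 0) (b₀ := T) (S := S)
    (locallyIntegrable_indicator_Ioc (h.integrableOn_energy hb hP hu hT))
    (locallyIntegrable_indicator_Ioc hρ) (locallyIntegrable_indicator_Ioc hfi)
    (by rw [norm_sq_indicator]; exact locallyIntegrable_indicator_Ioc hf2)
    (locallyIntegrable_indicator_Ioc hgi)
    (by rw [norm_sq_indicator]; exact locallyIntegrable_indicator_Ioc hg2) hC hS ?_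
  · filter_upwards [key] with a ha
    filter_upwards [ha] with b hab h0a hlt hbT
    have h1 := hab h0a hlt hbT
    have h2 : a ∈ Ioc 0 T := ⟨h0a, (hlt.trans hbT).le⟩
    have h3 : b ∈ Ioc 0 T := ⟨h0a.trans hlt, hbT.le⟩
    rw [norm_sq_indicator, norm_sq_indicator, indicator_of_mem h2, indicator_of_mem h3,
      intervalIntegral_indicator_Ioc h0a.le hlt.le hbT.le,
      intervalIntegral_indicator_Ioc h0a.le hlt.le hbT.le,
      intervalIntegral_indicator_Ioc h0a.le hlt.le hbT.le] at h1
    simp only [hg2e] at h1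
    rw [intervalIntegral.integral_const_mul, intervalIntegral.integral_const_mul] at h1
    exact h1
  · intro s hs t ht h0 hlt hT'
    have h2 : s ∈ Ioc 0 T := ⟨h0, (hlt.trans hT').le⟩
    have h3 : t ∈ Ioc 0 T := ⟨h0.trans hlt, hT'.le⟩
    rw [indicator_of_mem h2, indicator_of_mem h3, indicator_of_mem h3, indicator_of_mem h3,
      intervalIntegral_indicator_Ioc h0.le hlt.le hT'.le,
      intervalIntegral_indicator_Ioc h0.le hlt.le hT'.le,
      intervalIntegral_indicator_Ioc h0.le hlt.le hT'.le]
    refine (hinc s hs t ht h0 hlt).trans ?_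
    have h4 : ⟪g t, ∫ x in s..t, g x⟫ = κ * ⟪z t, ∫ x in s..t, z x⟫ := by
      rw [intervalIntegral.integral_smul, real_inner_smul_left, real_inner_smul_right,
        ← mul_assoc, hκ]
    have h5 : ‖u t - u s‖ * ‖y s‖ ≤ ∫ x in s..t, ρ x := by
      rw [intervalIntegral.integral_const_mul, mul_comm M]
      exact mul_le_mul (hu.norm_sub_le h0.le hlt.le) (hM s h2) (norm_nonneg _)
        (intervalIntegral.integral_nonneg hlt.le fun _ _ => norm_nonneg _)
    rw [h4]
    linarith

end Evolution

/-! ### Bounds that are uniform in time -/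

theorem le_of_mul_sq_le {α F G m : ℝ} (hα : 0 < α) (hF : 0 ≤ F) (hG : 0 ≤ G)
    (h : α * m ^ 2 ≤ F + G * m) : m ≤ 1 + (F + G) / α := by
  by_contra! hlt
  have h1 : 0 ≤ (F + G) / α := by positivity
  have h2 : α + (F + G) < α * m := by
    have := mul_lt_mul_of_pos_left hlt hα
    rwa [mul_add, mul_one, mul_div_cancel₀ _ hα.ne'] at this
  nlinarith

namespace Evolution

variable {Om : Set E3} [IsFiniteMeasure (mOm Om)]
  {lamA lamB : ℕ → ℝ} {eA eB : ℕ → Hs Om} {r σ : ℝ} {betah : ℝ → ℝ≥0∞}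
  {P p : ℝ → ℝ} {L : ℝ≥0} {hp : LipschitzWith L p} {u u' y μ z : ℝ → Hs Om} {κ : ℝ}

theorem exists_uniform_bounds (h : Evolution lamA lamB eA eB r σ betah hp u y μ z κ)
    (hb : LowerSemicontinuous betah) (hP : ∀ s, HasDerivAt P (p s) s) (hu : IsPrimitive u u')
    (hco : ∃ α : ℝ, 0 < α ∧ ∀ᶠ s : ℝ in Filter.comap (|·|) atTop,
      ENNReal.ofReal (α * s ^ 2 - P s) ≤ betah s) :
    ∃ a M : ℝ, 0 < a ∧
      (∀ t, a < t → inDom lamB eB σ (y t) ∧ ‖y t‖ ≤ M ∧ ‖fracPow lamB eB σ (y t)‖ ≤ M) ∧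
      IntegrableOn (fun t => ‖fracPow lamA eA r (μ t)‖ ^ 2) (Ioi a) ∧
      IntegrableOn (fun t => ‖z t‖ ^ 2) (Ioi a) := by
  obtain ⟨α, C, hα, hcoer⟩ := exists_coercivity hb hP hp hco (Om := Om)
  have hκ := h.pos_κ
  choose Mb hMb0 hMb using fun n : ℕ => h.exists_bounds (T := (n:ℝ) + 1) (by positivity)
  set m : ℕ → ℝ := fun n => sSup ((fun t => ‖y t‖) '' Ioc 0 ((n:ℝ) + 1)) with hm
  have hle : ∀ n : ℕ, ∀ t ∈ Ioc 0 ((n:ℝ) + 1), ‖y t‖ ≤ m n := fun n t ht =>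
    le_csSup ⟨Mb n, by rintro _ ⟨s, hs, rfl⟩; exact (hMb n s hs).2.1⟩ ⟨t, ht, rfl⟩
  have hm0 : ∀ n, 0 ≤ m n := fun n =>
    (norm_nonneg _).trans (hle n 1 ⟨one_pos, by simp⟩)
  have hen := ae_all_iff.2 fun n : ℕ =>
    h.energy_inequality hb hP hu (T := (n:ℝ) + 1) (by positivity) (hle n)
  obtain ⟨s, hs, -⟩ := exists_seq_tendsto_of_ae (ae_restrict_of_ae (s := Ioc (0:ℝ) 1) hen)
    (t := 1) ⟨one_pos, le_rfl⟩
  obtain ⟨⟨ha0, ha1⟩, ha⟩ := hs 0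
  set a := s 0
  set K := ∫ x in Ioi 0, ‖u' x‖
  have hK : 0 ≤ K := integral_nonneg fun _ => norm_nonneg _
  set G := ‖u 0‖ + K + K
  have hG : 0 ≤ G := by positivity
  set F := |C + energy lamB eB σ betah P (u a) (y a)| + α * (Mb 0) ^ 2
  have hF : 0 ≤ F := by positivity
  have hmain : ∀ n : ℕ, ∀ᵐ b, a < b → b < (n:ℝ) + 1 →
      1 / 2 * ‖fracPow lamB eB σ (y b)‖ ^ 2 + α * ‖y b‖ ^ 2
        + (∫ t in a..b, ‖fracPow lamA eA r (μ t)‖ ^ 2) + κ * (∫ t in a..b, ‖z t‖ ^ 2)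
        ≤ F + G * m n := by
    intro n
    filter_upwards [ha n, (ae_restrict_iff' measurableSet_Ioi).1 h.convexInt_lt_top]
      with b hb1 hb2 hab hbn
    have h1 := hb1 ha0 hab hbn
    have h2 := hcoer (y b) (hb2 (ha0.trans hab))
    have h3 := hle n b ⟨ha0.trans hab, hbn.le⟩
    have h4 := (real_inner_le_norm (u b) (y b)).trans
      (mul_le_mul (hu.norm_le (ha0.trans hab).le) h3 (norm_nonneg _) (by positivity))
    have h5 := mul_le_mul_of_nonneg_left (hu.integral_norm_le ha0.le hab.le) (hm0 n)
    have h6 := le_abs_self (C + energy lamB eB σ betah P (u a) (y a))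
    have h7 : 0 ≤ α * (Mb 0) ^ 2 := by positivity
    rw [energy] at h1
    linarith
  have hint0 : ∀ (f : ℝ → Hs Om) (b : ℝ), a < b → 0 ≤ ∫ t in a..b, ‖f t‖ ^ 2 := fun f b hab =>
    intervalIntegral.integral_nonneg hab.le fun _ _ => by positivity
  have hmle : ∀ n, m n ≤ 1 + (F + G) / α := by
    intro n
    refine le_of_mul_sq_le hα hF hG ?_
    have hR : 0 ≤ (F + G * m n) / α := div_nonneg (add_nonneg hF (mul_nonneg hG (hm0 n))) hα.le
    have h1 : ∀ t ∈ Ioc a ((n:ℝ) + 1), ‖y t‖ ≤ √((F + G * m n) / α) := by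
      refine fun t ht => (h.bounds_of_ae_bounds ha0.le (D := Mb n) ?_ t ht).2.1
      rw [ae_restrict_iff' measurableSet_Ioc]
      filter_upwards [hmain n, Measure.ae_ne volume ((n:ℝ) + 1)] with b h1 h2 hbm
      have h3 := hMb n b ⟨ha0.trans hbm.1, hbm.2⟩
      refine ⟨h3.1, Real.le_sqrt_of_sq_le ((le_div_iff₀' hα).2 ?_), h3.2.2⟩
      have h4 := h1 hbm.1 (lt_of_le_of_ne hbm.2 h2)
      have h5 := hint0 (fun t => fracPow lamA eA r (μ t)) b hbm.1
      have h6 := mul_nonneg hκ.le (hint0 z b hbm.1)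
      linarith [sq_nonneg ‖fracPow lamB eB σ (y b)‖]
    have h2 : m n ≤ √((F + G * m n) / α) := by
      refine csSup_le ⟨_, 1, ⟨one_pos, by simp⟩, rfl⟩ ?_
      rintro _ ⟨t, ht, rfl⟩
      rcases lt_or_ge a t with hat | hat
      · exact h1 t ⟨hat, ht.2⟩
      · refine Real.le_sqrt_of_sq_le ((le_div_iff₀' hα).2 ?_)
        have h3 := (hMb 0 t ⟨ht.1, by simpa using hat.trans ha1⟩).2.1
        have h4 : α * ‖y t‖ ^ 2 ≤ α * (Mb 0) ^ 2 := by gcongr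
        have h5 := abs_nonneg (C + energy lamB eB σ betah P (u a) (y a))
        have h6 := mul_nonneg hG (hm0 n)
        linarith
    have h3 := pow_le_pow_left₀ (hm0 n) h2 2
    rwa [Real.sq_sqrt hR, le_div_iff₀' hα] at h3
  set Q := F + G * (1 + (F + G) / α)
  have hQ : 0 ≤ Q := by positivity
  have hfin : ∀ᵐ b, a < b →
      1 / 2 * ‖fracPow lamB eB σ (y b)‖ ^ 2 + α * ‖y b‖ ^ 2
        + (∫ t in a..b, ‖fracPow lamA eA r (μ t)‖ ^ 2) + κ * (∫ t in a..b, ‖z t‖ ^ 2) ≤ Q := by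
    filter_upwards [ae_all_iff.2 hmain] with b hb hab
    obtain ⟨n, hn⟩ := exists_nat_ge b
    have h1 := mul_le_mul_of_nonneg_left (hmle n) hG
    linarith [hb n hab (hn.trans_lt (lt_add_one _))]
  have hgood : ∀ n : ℕ, ∃ b, (n:ℝ) + a < b ∧
      1 / 2 * ‖fracPow lamB eB σ (y b)‖ ^ 2 + α * ‖y b‖ ^ 2
        + (∫ t in a..b, ‖fracPow lamA eA r (μ t)‖ ^ 2) + κ * (∫ t in a..b, ‖z t‖ ^ 2) ≤ Q := by
    intro n
    obtain ⟨b, hb, -⟩ := exists_seq_tendsto_of_ae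
      (ae_restrict_of_ae (s := Ioc ((n:ℝ) + a) (n + a + 1)) hfin)
      (t := (n:ℝ) + a + 1) ⟨lt_add_one _, le_rfl⟩
    refine ⟨b 0, (hb 0).1.1, (hb 0).2 (lt_of_le_of_lt ?_ (hb 0).1.1)⟩
    simp
  have htend : Tendsto (fun n : ℕ => (n:ℝ) + a) atTop atTop :=
    tendsto_atTop_add_const_right _ _ tendsto_natCast_atTop_atTop
  have hsq : ∀ {f : ℝ → Hs Om}, (∀ T, 0 < T → MemLp f 2 (volume.restrict (Ioc 0 T))) →
      (∃ R, ∀ n : ℕ, ∃ b, (n:ℝ) + a < b ∧ ∫ t in a..b, ‖f t‖ ^ 2 ≤ R) →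
      IntegrableOn (fun t => ‖f t‖ ^ 2) (Ioi a) := by
    rintro f hf ⟨R, hR⟩
    have hi := integrableOn_sq_of_memLp_two hf
    refine integrableOn_Ioi_of_intervalIntegral_norm_bounded R a
      (fun n : ℕ => (hi (n + a) (by positivity)).mono_set (Ioc_subset_Ioc_left ha0.le)) htend
      (Eventually.of_forall fun n => ?_)
    obtain ⟨b, hb1, hb2⟩ := hR n
    have han : a ≤ (n:ℝ) + a := by simp
    simp only [norm_pow, norm_norm]
    refine le_trans ?_ hb2
    exact intervalIntegral.integral_mono_interval le_rfl han hb1.le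
      (Eventually.of_forall fun x => by positivity)
      (intervalIntegrable_of_Ioc hi ha0.le (han.trans hb1.le))
  refine ⟨a, max √(Q / α) √(2 * Q), ha0, fun t ht => ?_, hsq h.memLp_flux ⟨Q, fun n => ?_⟩,
    hsq h.memLp_z ⟨Q / κ, fun n => ?_⟩⟩
  · obtain ⟨M, -, hM⟩ := h.exists_bounds (ha0.trans ht)
    refine h.bounds_of_ae_bounds ha0.le (T := t) ?_ t ⟨ht, le_rfl⟩
    rw [ae_restrict_iff' measurableSet_Ioc]
    filter_upwards [hfin] with b hb hbm
    have h1 := hb hbm.1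
    have h5 := hint0 (fun t => fracPow lamA eA r (μ t)) b hbm.1
    have h6 := mul_nonneg hκ.le (hint0 z b hbm.1)
    have h7 : 0 ≤ α * ‖y b‖ ^ 2 := by positivity
    refine ⟨(hM b ⟨ha0.trans hbm.1, hbm.2⟩).1,
      le_max_of_le_left (Real.le_sqrt_of_sq_le ((le_div_iff₀' hα).2 ?_)),
      le_max_of_le_right (Real.le_sqrt_of_sq_le ?_)⟩ <;>
    linarith [sq_nonneg ‖fracPow lamB eB σ (y b)‖]
  · obtain ⟨b, hb1, hb2⟩ := hgood n
    have hab : a < b := lt_of_le_of_lt (by simp) hb1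
    have h6 := mul_nonneg hκ.le (hint0 z b hab)
    have h7 : 0 ≤ α * ‖y b‖ ^ 2 := by positivity
    exact ⟨b, hb1, by linarith [sq_nonneg ‖fracPow lamB eB σ (y b)‖]⟩
  · obtain ⟨b, hb1, hb2⟩ := hgood n
    have hab : a < b := lt_of_le_of_lt (by simp) hb1
    have h5 := hint0 (fun t => fracPow lamA eA r (μ t)) b hab
    have h7 : 0 ≤ α * ‖y b‖ ^ 2 := by positivity
    refine ⟨b, hb1, (le_div_iff₀' hκ).2 ?_⟩
    linarith [sq_nonneg ‖fracPow lamB eB σ (y b)‖]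

end Evolution

/-! ### Passage to the limit -/

section Limit

theorem tendsto_integral_unit_interval {G : ℝ → ℝ} {a : ℝ} (hG : IntegrableOn G (Ioi a))
    {t : ℕ → ℝ} (hta : ∀ n, a < t n) (ht : Tendsto t atTop atTop) :
    Tendsto (fun n => ∫ x in t n..t n + 1, G x) atTop (𝓝 0) := by
  have h1 := intervalIntegral_tendsto_integral_Ioi a hG ht
  have h2 := intervalIntegral_tendsto_integral_Ioi a hG (tendsto_atTop_add_const_right _ 1 ht)
  have h3 := h2.sub h1
  rw [sub_self] at h3
  have hi : ∀ b, a ≤ b → IntervalIntegrable G volume a b := fun b hb =>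
    (intervalIntegrable_iff_integrableOn_Ioc_of_le hb).2 (hG.mono_set Ioc_subset_Ioi_self)
  refine h3.congr fun n => ?_
  exact intervalIntegral.integral_interval_sub_left (hi _ ((hta n).le.trans (by simp)))
    (hi _ (hta n).le)

/-- For a nonnegative integrable function on a half line there are times close to given
diverging ones at which the function tends to zero. -/
theorem exists_times_tendsto_zero {G : ℝ → ℝ} {a : ℝ} (hG0 : ∀ x, 0 ≤ G x)
    (hG : IntegrableOn G (Ioi a)) {Q : ℝ → Prop} (hQ : ∀ᵐ x ∂(volume.restrict (Ioi a)), Q x)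
    {t : ℕ → ℝ} (hta : ∀ n, a < t n) (ht : Tendsto t atTop atTop) :
    ∃ s : ℕ → ℝ, (∀ n, t n < s n ∧ s n ≤ t n + 1 ∧ Q (s n)) ∧
      Tendsto (fun n => G (s n)) atTop (𝓝 0) := by
  have hex : ∀ n, ∃ s, (t n < s ∧ s ≤ t n + 1 ∧ Q s) ∧ G s ≤ ∫ x in t n..t n + 1, G x := by
    intro n
    have hsub : Ioc (t n) (t n + 1) ⊆ Ioi a := Ioc_subset_Ioi_self.trans (Ioi_subset_Ioi (hta n).le)
    have : IsProbabilityMeasure (volume.restrict (Ioc (t n) (t n + 1))) :=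
      ⟨by simp⟩
    have hae := (ae_restrict_mem (μ := (volume : Measure ℝ))
      (measurableSet_Ioc (a := t n) (b := t n + 1))).and
      (ae_restrict_of_ae_restrict_of_subset hsub hQ)
    obtain ⟨s, hs, hle⟩ := exists_notMem_null_le_integral (hG.mono_set hsub) hae
    have hs' := not_not.1 hs
    refine ⟨s, ⟨hs'.1.1, hs'.1.2, hs'.2⟩, ?_⟩
    rwa [intervalIntegral.integral_of_le (by simp)]
  choose s hs hle using hex
  exact ⟨s, hs, squeeze_zero (fun _ => hG0 _) hle (tendsto_integral_unit_interval hG hta ht)⟩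

variable {Om : Set E3} {e : ℕ → Hs Om} {lam : ℕ → ℝ} {ρ : ℝ}

theorem IsCompleteSystem.tendsto_inner (he : IsCompleteSystem e) {x : ℕ → Hs Om} {x₀ : Hs Om}
    {M : ℝ} (hM : ∀ n, ‖x n‖ ≤ M)
    (hlim : ∀ j, Tendsto (fun n => ⟪x n, e j⟫) atTop (𝓝 ⟪x₀, e j⟫)) (v : Hs Om) :
    Tendsto (fun n => ⟪x n, v⟫) atTop (𝓝 ⟪x₀, v⟫) := by
  have hspan : ∀ v ∈ Submodule.span ℝ (range e),
      Tendsto (fun n => ⟪x n, v⟫) atTop (𝓝 ⟪x₀, v⟫) := by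
    intro v hv
    induction hv using Submodule.span_induction with
    | mem v hv => obtain ⟨j, rfl⟩ := hv; exact hlim j
    | zero => simp
    | add v w _ _ hv hw => simpa only [inner_add_right] using hv.add hw
    | smul c v _ hv => simpa only [real_inner_smul_right] using hv.const_mul c
  have hM0 : 0 ≤ M := (norm_nonneg _).trans (hM 0)
  rw [Metric.tendsto_atTop]
  intro ε hε
  have hv : v ∈ closure (Submodule.span ℝ (range e) : Set (Hs Om)) := by
    rw [← Submodule.topologicalClosure_coe, he.2]
    trivial
  obtain ⟨w, hw, hvw⟩ := Metric.mem_closure_iff.1 hv (ε / (2 * (M + ‖x₀‖ + 1))) (by positivity)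
  obtain ⟨N, hN⟩ := Metric.tendsto_atTop.1 (hspan w hw) (ε / 2) (by positivity)
  refine ⟨N, fun n hn => ?_⟩
  have h1 := hN n hn
  rw [Real.dist_eq] at h1 ⊢
  have h2 : ⟪x n, v⟫ - ⟪x₀, v⟫ = ⟪x n - x₀, v - w⟫ + (⟪x n, w⟫ - ⟪x₀, w⟫) := by
    rw [inner_sub_left, inner_sub_right, inner_sub_right]
    ring
  have h3 := abs_real_inner_le_norm (x n - x₀) (v - w)
  have h4 : ‖x n - x₀‖ * ‖v - w‖ ≤ (M + ‖x₀‖ + 1) * (ε / (2 * (M + ‖x₀‖ + 1))) := by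
    rw [dist_eq_norm] at hvw
    refine mul_le_mul ?_ hvw.le (norm_nonneg _) (by positivity)
    linarith [norm_sub_le (x n) x₀, hM n]
  have h5 : (M + ‖x₀‖ + 1) * (ε / (2 * (M + ‖x₀‖ + 1))) = ε / 2 := by
    have : M + ‖x₀‖ + 1 ≠ 0 := by positivity
    field_simp
  rw [h2]
  linarith [abs_add_le ⟪x n - x₀, v - w⟫ (⟪x n, w⟫ - ⟪x₀, w⟫)]

theorem IsCompleteSystem.innerFrac_basis (he : IsCompleteSystem e) {v : Hs Om}
    (hv : inDom lam e ρ v) (j : ℕ) :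
    innerFrac lam e ρ v (e j) = (1 + (lam j ^ ρ) ^ 2) * ⟪v, e j⟫ := by
  have h1 : fracPow lam e ρ (e j) = lam j ^ ρ • e j := he.ext fun k => by
    rw [he.inner_fracPow (he.inDom_basis j), real_inner_smul_left, he.inner_basis]
    split_ifs with h
    · rw [h]
    · simp
  rw [innerFrac, h1, real_inner_smul_right, he.inner_fracPow hv]
  ring

theorem IsCompleteSystem.tendsto_of_innerFrac (he : IsCompleteSystem e)
    (hlam : Tendsto lam atTop atTop) (hρ : 0 < ρ) {v : ℕ → Hs Om} {w : Hs Om}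
    (hv : ∀ n, inDom lam e ρ (v n)) (hw : inDom lam e ρ w) {M : ℝ}
    (hM : ∀ n, ‖fracPow lam e ρ (v n)‖ ≤ M)
    (hlim : ∀ φ, inDom lam e ρ φ →
      Tendsto (fun n => innerFrac lam e ρ (v n) φ) atTop (𝓝 (innerFrac lam e ρ w φ))) :
    Tendsto v atTop (𝓝 w) := by
  refine he.tendsto_of_coeff hlam hρ hv hw hM fun j => ?_
  have h1 := hlim (e j) (he.inDom_basis j)
  simp only [he.innerFrac_basis hw, fun n => he.innerFrac_basis (hv n)] at h1
  have h2 : (1 + (lam j ^ ρ) ^ 2) ≠ 0 := by positivity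
  have h3 := h1.const_mul (1 + (lam j ^ ρ) ^ 2)⁻¹
  simp only [inv_mul_cancel_left₀ h2] at h3
  exact h3

variable [IsFiniteMeasure (mOm Om)]

/-- Stability of the variational inequality under strong convergence. -/
theorem variational_limit (he : IsCompleteSystem e) {betah : ℝ → ℝ≥0∞}
    (hb : LowerSemicontinuous betah) {p : ℝ → ℝ} {L : ℝ≥0} (hp : LipschitzWith L p)
    {x ξ ζ f : ℕ → Hs Om} {w f₀ : Hs Om} {M : ℝ}
    (hx : ∀ n, inDom lam e ρ (x n)) (hM : ∀ n, ‖fracPow lam e ρ (x n)‖ ≤ M)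
    (hxβ : ∀ n, convexInt Om betah (x n) < ⊤) (hw : inDom lam e ρ w)
    (hxw : Tendsto x atTop (𝓝 w)) (hξ : Tendsto ξ atTop (𝓝 0)) (hζ : Tendsto ζ atTop (𝓝 0))
    (hf : Tendsto f atTop (𝓝 f₀)) {v : Hs Om}
    (hvar : ∀ n, ⟪ζ n, x n - v⟫
        + ⟪fracPow lam e ρ (x n), fracPow lam e ρ (x n) - fracPow lam e ρ v⟫
        + (convexInt Om betah (x n)).toReal + ⟪superposition hp (x n) - f n, x n - v⟫
        ≤ ⟪ξ n, x n - v⟫ + (convexInt Om betah v).toReal) :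
    convexInt Om betah w < ⊤ ∧
      ⟪fracPow lam e ρ w, fracPow lam e ρ w - fracPow lam e ρ v⟫
        + (convexInt Om betah w).toReal + ⟪superposition hp w - f₀, w - v⟫
        ≤ (convexInt Om betah v).toReal := by
  set c : ℕ → ℝ := fun n => ⟪fracPow lam e ρ (x n), fracPow lam e ρ v⟫ + ⟪ξ n, x n - v⟫
    - ⟪ζ n, x n - v⟫ - ⟪superposition hp (x n) - f n, x n - v⟫ + (convexInt Om betah v).toReal
  set c₀ : ℝ := ⟪fracPow lam e ρ w, fracPow lam e ρ v⟫
    - ⟪superposition hp w - f₀, w - v⟫ + (convexInt Om betah v).toReal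
  have hxv : Tendsto (fun n => x n - v) atTop (𝓝 (w - v)) := hxw.sub_const v
  have hB : Tendsto (fun n => ⟪fracPow lam e ρ (x n), fracPow lam e ρ v⟫) atTop
      (𝓝 ⟪fracPow lam e ρ w, fracPow lam e ρ v⟫) := by
    refine he.tendsto_inner hM (fun j => ?_) _
    simp only [he.inner_fracPow hw, fun n => he.inner_fracPow (hx n)]
    exact (hxw.inner tendsto_const_nhds).const_mul _
  have hc : Tendsto c atTop (𝓝 c₀) := by
    have h1 := (((hB.add (hξ.inner hxv)).sub (hζ.inner hxv)).sub
      ((((continuous_superposition hp).tendsto w).comp hxw |>.sub hf).inner hxv)).add_const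
      (convexInt Om betah v).toReal
    simp only [inner_zero_left, add_zero, sub_zero] at h1
    exact h1
  have hle : ∀ n, ‖fracPow lam e ρ (x n)‖ ^ 2 + (convexInt Om betah (x n)).toReal ≤ c n := by
    intro n
    have h1 := hvar n
    rw [inner_sub_right (fracPow lam e ρ (x n)), real_inner_self_eq_norm_sq] at h1
    simp only [c]
    linarith
  have hc₀ : 0 ≤ c₀ := ge_of_tendsto' hc fun n => le_trans (by positivity) (hle n)
  have hlsc : LowerSemicontinuous
      (fun v : Hs Om => specEnergy lam e ρ v + convexInt Om betah v) :=
    lowerSemicontinuous_specEnergy.add (lowerSemicontinuous_convexInt hb)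
  have hw' : specEnergy lam e ρ w + convexInt Om betah w ≤ ENNReal.ofReal c₀ := by
    refine le_of_forall_lt fun d hd => ?_
    obtain ⟨d', hdd', hd'⟩ := exists_between hd
    refine hdd'.trans_le (ge_of_tendsto ((ENNReal.continuous_ofReal.tendsto c₀).comp hc)
      ((hxw.eventually (hlsc w d' hd')).mono fun n hn => hn.le.trans ?_))
    change specEnergy lam e ρ (x n) + convexInt Om betah (x n) ≤ ENNReal.ofReal (c n)
    rw [he.specEnergy_eq (hx n), ← ENNReal.ofReal_toReal (hxβ n).ne,
      ← ENNReal.ofReal_add (by positivity) (by positivity)]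
    exact ENNReal.ofReal_le_ofReal (hle n)
  have hwβ : convexInt Om betah w < ⊤ :=
    (le_add_self.trans hw').trans_lt ENNReal.ofReal_lt_top
  refine ⟨hwβ, ?_⟩
  rw [he.specEnergy_eq hw, ← ENNReal.ofReal_toReal hwβ.ne,
    ← ENNReal.ofReal_add (by positivity) (by positivity),
    ENNReal.ofReal_le_ofReal_iff hc₀] at hw'
  rw [inner_sub_right (fracPow lam e ρ w), real_inner_self_eq_norm_sq]
  linarith

end Limit

namespace Evolution

variable {Om : Set E3} [IsFiniteMeasure (mOm Om)]
  {lamA lamB : ℕ → ℝ} {eA eB : ℕ → Hs Om} {r σ : ℝ} {betah : ℝ → ℝ≥0∞}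
  {p : ℝ → ℝ} {L : ℝ≥0} {hp : LipschitzWith L p} {u u' y μ z : ℝ → Hs Om} {κ : ℝ}

/-- Small fluxes over bounded time intervals force small increments of `y`. -/
theorem tendsto_increment (h : Evolution lamA lamB eA eB r σ betah hp u y μ z κ) {a M : ℝ}
    (ha : 0 < a) (hbd : ∀ t, a < t →
      inDom lamB eB σ (y t) ∧ ‖y t‖ ≤ M ∧ ‖fracPow lamB eB σ (y t)‖ ≤ M)
    (hflux : IntegrableOn (fun t => ‖fracPow lamA eA r (μ t)‖ ^ 2) (Ioi a))
    {s t : ℕ → ℝ} (hta : ∀ n, a < t n) (ht : Tendsto t atTop atTop)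
    (hts : ∀ n, t n < s n ∧ s n ≤ t n + 1) :
    Tendsto (fun n => y (s n) - y (t n)) atTop (𝓝 0) := by
  have hM : 0 ≤ M := (norm_nonneg _).trans (hbd _ (hta 0)).2.1
  set J : ℕ → ℝ := fun n => ∫ x in t n..t n + 1, ‖fracPow lamA eA r (μ x)‖ ^ 2
  have hJ : Tendsto J atTop (𝓝 0) := tendsto_integral_unit_interval hflux hta ht
  have hq : ∀ n, ‖∫ x in t n..s n, fracPow lamA eA r (μ x)‖ ^ 2 ≤ J n := by
    intro n
    have ht0 : 0 ≤ t n := (ha.trans (hta n)).le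
    have h0 : 0 ≤ ∫ x in t n..s n, ‖fracPow lamA eA r (μ x)‖ ^ 2 :=
      intervalIntegral.integral_nonneg (hts n).1.le fun _ _ => by positivity
    refine (h.norm_integral_flux_sq_le ht0 (hts n).1.le).trans
      ((mul_le_of_le_one_left h0 (by linarith [(hts n).2])).trans ?_)
    exact intervalIntegral.integral_mono_interval le_rfl (hts n).1.le (hts n).2
      (Eventually.of_forall fun x => by positivity)
      (intervalIntegrable_of_Ioc (integrableOn_sq_of_memLp_two h.memLp_flux) ht0 (by simp))
  rw [Metric.tendsto_atTop]
  intro ε hε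
  obtain ⟨C, hC, hehr⟩ := ehrling h.completeA h.completeB h.tendstoB h.pos_σ
    (ε := ε ^ 2 / (2 * (8 * M ^ 2 + 1))) (by positivity) (lamA := lamA) (r := r)
  have hCJ : Tendsto (fun n => C * J n) atTop (𝓝 0) := by simpa using hJ.const_mul C
  obtain ⟨N, hN⟩ := eventually_atTop.1
    (hCJ.eventually (gt_mem_nhds (by positivity : 0 < ε ^ 2 / 2)))
  refine ⟨N, fun n hn => ?_⟩
  have h1 := hbd _ (hta n)
  have h2 := hbd _ ((hta n).trans (hts n).1)
  have h3 := hehr _ _ (inDom_sub h2.1 h1.1)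
    (h.increment (t n) (s n) (ha.trans (hta n)).le (hts n).1.le)
  rw [h.completeB.fracPow_sub h2.1 h1.1] at h3
  have h4 : ‖y (s n) - y (t n)‖ ≤ 2 * M := by
    linarith [norm_sub_le (y (s n)) (y (t n)), h1.2.1, h2.2.1]
  have h5 : ‖fracPow lamB eB σ (y (s n)) - fracPow lamB eB σ (y (t n))‖ ≤ 2 * M := by
    linarith [norm_sub_le (fracPow lamB eB σ (y (s n))) (fracPow lamB eB σ (y (t n))),
      h1.2.2, h2.2.2]
  have h6 := pow_le_pow_left₀ (norm_nonneg _) h4 2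
  have h7 := pow_le_pow_left₀ (norm_nonneg _) h5 2
  have h8 : ε ^ 2 / (2 * (8 * M ^ 2 + 1)) * (‖y (s n) - y (t n)‖ ^ 2
      + ‖fracPow lamB eB σ (y (s n)) - fracPow lamB eB σ (y (t n))‖ ^ 2) ≤ ε ^ 2 / 2 := by
    refine (mul_le_mul_of_nonneg_left (by linarith : _ ≤ 8 * M ^ 2 + 1) (by positivity)).trans
      (le_of_eq ?_)
    have : 8 * M ^ 2 + 1 ≠ 0 := by positivity
    field_simp
  have h9 := mul_le_mul_of_nonneg_left (hq n) hC
  rw [dist_zero_right]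
  exact lt_of_pow_lt_pow_left₀ 2 hε.le (by linarith [hN n hn])

theorem variational_omegaLimit (h : Evolution lamA lamB eA eB r σ betah hp u y μ z κ)
    (hb : LowerSemicontinuous betah) (hmono : Monotone lamA) (h0 : 0 < lamA 0) (hr : 0 < r)
    {a M : ℝ} (ha : 0 < a) (hbd : ∀ t, a < t →
      inDom lamB eB σ (y t) ∧ ‖y t‖ ≤ M ∧ ‖fracPow lamB eB σ (y t)‖ ≤ M)
    (hflux : IntegrableOn (fun t => ‖fracPow lamA eA r (μ t)‖ ^ 2) (Ioi a))
    (hz : IntegrableOn (fun t => ‖z t‖ ^ 2) (Ioi a)) {uinf : Hs Om}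
    (hu : Tendsto u atTop (𝓝 uinf)) {w : Hs Om} (hw : w ∈ omegaLimit lamB eB σ y) {v : Hs Om}
    (hv : inDom lamB eB σ v) (hvβ : convexInt Om betah v < ⊤) :
    convexInt Om betah w < ⊤ ∧
      ⟪fracPow lamB eB σ w, fracPow lamB eB σ w - fracPow lamB eB σ v⟫
        + (convexInt Om betah w).toReal + ⟪superposition hp w - uinf, w - v⟫
        ≤ (convexInt Om betah v).toReal := by
  obtain ⟨hwd, tn, -, -, htn, hweak⟩ := hw
  obtain ⟨N, hN⟩ := eventually_atTop.1 (htn.eventually_gt_atTop a)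
  set t : ℕ → ℝ := fun n => tn (n + N)
  have hta : ∀ n, a < t n := fun n => hN _ (Nat.le_add_left N n)
  have ht : Tendsto t atTop atTop := htn.comp (tendsto_add_atTop_nat N)
  have hyt : Tendsto (fun n => y (t n)) atTop (𝓝 w) :=
    h.completeB.tendsto_of_innerFrac h.tendstoB h.pos_σ (fun n => (hbd _ (hta n)).1) hwd
      (fun n => (hbd _ (hta n)).2.2) fun φ hφ => (hweak φ hφ).comp (tendsto_add_atTop_nat N)
  have hgood := ae_restrict_of_ae_restrict_of_subset (Ioi_subset_Ioi ha.le)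
    (h.inDom_μ.and (h.convexInt_lt_top.and h.variational))
  obtain ⟨s, hs, hlim⟩ := exists_times_tendsto_zero
    (G := fun x => ‖fracPow lamA eA r (μ x)‖ ^ 2 + ‖z x‖ ^ 2) (fun x => by positivity)
    (hflux.add hz) hgood hta ht
  have hst : Tendsto s atTop atTop := tendsto_atTop_mono (fun n => (hs n).1.le) ht
  have hsqrt : ∀ {x : ℕ → Hs Om}, Tendsto (fun n => ‖x n‖ ^ 2) atTop (𝓝 0) →
      Tendsto x atTop (𝓝 0) := fun {x} hx => by
    rw [tendsto_zero_iff_norm_tendsto_zero]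
    simpa [Function.comp_def, Real.sqrt_sq] using (Real.continuous_sqrt.tendsto 0).comp hx
  have hzs : Tendsto (fun n => z (s n)) atTop (𝓝 0) :=
    hsqrt (squeeze_zero (fun _ => by positivity)
      (fun n => le_add_of_nonneg_left (by positivity)) hlim)
  have hgs : Tendsto (fun n => fracPow lamA eA r (μ (s n))) atTop (𝓝 0) :=
    hsqrt (squeeze_zero (fun _ => by positivity)
      (fun n => le_add_of_nonneg_right (by positivity)) hlim)
  have hμs : Tendsto (fun n => μ (s n)) atTop (𝓝 0) := by
    have h1 : 0 < lamA 0 ^ r := Real.rpow_pos_of_pos h0 r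
    refine squeeze_zero_norm (fun n => ?_)
      (by simpa using hgs.norm.const_mul (lamA 0 ^ r)⁻¹)
    exact (le_inv_mul_iff₀ h1).2 (h.completeA.norm_le_fracPow hmono h0 hr (hs n).2.2.1)
  have hys : Tendsto (fun n => y (s n)) atTop (𝓝 w) := by
    simpa using (h.tendsto_increment ha hbd hflux hta ht
      fun n => ⟨(hs n).1, (hs n).2.1⟩).add hyt
  have hsa : ∀ n, a < s n := fun n => (hta n).trans (hs n).1
  exact variational_limit h.completeB hb hp (fun n => (hbd _ (hsa n)).1)
    (fun n => (hbd _ (hsa n)).2.2) (fun n => (hs n).2.2.2.1) hwd hys hμs hzs (hu.comp hst)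
    fun n => (hs n).2.2.2.2 v hv hvβ

end Evolution

/-- **Theorem 2.2, case `λ₁ > 0`.** Under the structural assumptions and the assumptions
on the data, with `u - u_∞ ∈ L²(0,+∞;H)`, if `λ₁ > 0` then every element `y_ω` of the
ω-limit set of `y` is a stationary solution: it satisfies the variational inequality
`(B^σ y_ω, B^σ(y_ω - v)) + ∫_Om β̂(y_ω) + (π(y_ω) - u_∞, y_ω - v) ≤ ∫_Om β̂(v)`
for every `v ∈ V_B^σ`. -/
theorem omega_limit_characterization_positive
    (Om : Set E3) (lamA lamB : ℕ → ℝ) (eA eB : ℕ → Hs Om) (r σ τ : ℝ)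
    (betah : ℝ → ℝ≥0∞) (pih piF : ℝ → ℝ) (Lpi : ℝ≥0)
    (u u' : ℝ → Hs Om) (y0 : Hs Om)
    (hset : SettingHyps Om lamA lamB eA eB r σ τ)
    (hdata : DataHyps Om lamA lamB eB σ betah pih piF Lpi u u' y0)
    (uinf : Hs Om) (hui : IntegrableOn (fun t => ‖u t - uinf‖ ^ 2) (Set.Ioi (0:ℝ)))
    (y μ : ℝ → Hs Om) (dy : ℝ → Hs Om →ₗ[ℝ] ℝ) (z : ℝ → Hs Om)
    (hsol : IsSolution Om lamA lamB eA eB r σ τ betah piF u y0 y μ dy z)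
    (hlam : 0 < lamA 0) :
    ∀ w ∈ omegaLimit lamB eB σ y,
      (∫⁻ x, betah (w x) ∂(mOm Om)) < ⊤ ∧
      ∀ v : Hs Om, inDom lamB eB σ v → (∫⁻ x, betah (v x) ∂(mOm Om)) < ⊤ →
        ⟪fracPow lamB eB σ w, fracPow lamB eB σ w - fracPow lamB eB σ v⟫
          + (∫⁻ x, betah (w x) ∂(mOm Om)).toReal
          + ∫ x, (piF (w x) - uinf x) * (w x - v x) ∂(mOm Om)
          ≤ (∫⁻ x, betah (v x) ∂(mOm Om)).toReal := by
  obtain ⟨-, -, hbdd, -, -, hmono, -, -, -, -, -, -, -, hr, -⟩ := id hset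
  obtain ⟨-, hb, -, hP, hp, hco, hu'1, hu'2, hy0, hy0β, -⟩ := hdata
  have : IsFiniteMeasure (mOm Om) := isFiniteMeasure_restrict.2 hbdd.measure_lt_top.ne
  have hu : IsPrimitive u u' := ⟨hu'1, hu'2⟩
  obtain ⟨κ, h⟩ := hsol.evolution hset hb hp
  obtain ⟨a, M, ha, hbd, hflux, hz⟩ := h.exists_uniform_bounds hb hP hu hco
  intro w hw
  have key : ∀ v : Hs Om, inDom lamB eB σ v → convexInt Om betah v < ⊤ → _ := fun v hv hvβ =>
    h.variational_omegaLimit hb hmono hlam hr ha hbd hflux hz (hu.tendsto hui) hw hv hvβ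
  refine ⟨(key y0 hy0 hy0β).1, fun v hv hvβ => ?_⟩
  rw [integral_superposition_sub hp]
  exact (key v hv hvβ).2

end FracCH
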